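/- Let G be a connected graph of order n ≥ 6. Then: (i) G ∈ 𝒢^2(n) if and only if G ∈ 𝒢_1^2(n) ∪ 𝒢_2^2(n) ∪ 𝒢_3^2(n) or G ∈ 𝓓*; (ii) for every 3 ≤ s ≤ n−3, G ∈ 𝒢^s(n) if and only if G ∈ 𝒢_1^s(n) ∪ 𝒢_2^s(n) ∪ 𝒢_3^s(n). -/

import Mathlib

open Matrix BigOperators

namespace TwoPosEig

variable {V : Type*}

/-- The real adjacency matrix of a simple graph (classical decidability). -/
noncomputable def adjMat [Fintype V] [DecidableEq V] (G : SimpleGraph V) : Matrix V V ℝ :=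
  letI := Classical.decRel G.Adj
  G.adjMatrix ℝ

lemma adjMat_isHermitian [Fintype V] [DecidableEq V] (G : SimpleGraph V) :
    (adjMat G).IsHermitian := by
  letI := Classical.decRel G.Adj
  rw [Matrix.IsHermitian, Matrix.conjTranspose_eq_transpose_of_trivial]
  exact SimpleGraph.isSymm_adjMatrix G

/-- The eigenvalues of (the adjacency matrix of) a graph, as a function on vertices. -/
noncomputable def eigs [Fintype V] [DecidableEq V] (G : SimpleGraph V) : V → ℝ :=
  (adjMat_isHermitian G).eigenvalues

/-- `p(G)`: the number of positive eigenvalues (with multiplicity). -/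
noncomputable def posCount [Finite V] (G : SimpleGraph V) : ℕ :=
  letI := Fintype.ofFinite V
  letI := Classical.decEq V
  Nat.card {i : V // 0 < eigs G i}

/-- `η(G)`: the number of zero eigenvalues (with multiplicity), the nullity. -/
noncomputable def nullCount [Finite V] (G : SimpleGraph V) : ℕ :=
  letI := Fintype.ofFinite V
  letI := Classical.decEq V
  Nat.card {i : V // eigs G i = 0}

/-- `λ_k(G)`: the `k`-th largest eigenvalue (1-indexed); junk value `0` out of range. -/
noncomputable def lam [Finite V] (G : SimpleGraph V) (k : ℕ) : ℝ :=
  letI := Fintype.ofFinite V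
  letI := Classical.decEq V
  (((Finset.univ.val.map (eigs G)).sort (· ≤ ·)).reverse).getD (k - 1) 0

/-- Membership in `𝒢^s(n)` (the order `n` being the cardinality of the vertex type):
`p(G) = 2` and `η(G) = s`. -/
def memClass [Finite V] (s : ℕ) (G : SimpleGraph V) : Prop :=
  posCount G = 2 ∧ nullCount G = s

/-- `v` is a congruent vertex of I-type: some other vertex `u`, non-adjacent to `v`,
has the same neighbourhood. -/
def ITypeVertex (G : SimpleGraph V) (v : V) : Prop :=
  ∃ u, u ≠ v ∧ ¬ G.Adj u v ∧ G.neighborSet u = G.neighborSet v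

/-- `u` is a congruent vertex of II-type: there are two non-adjacent vertices `v, w`
such that `N(u)` is a disjoint union of `N(v)` and `N(w)`. -/
def IITypeVertex (G : SimpleGraph V) (u : V) : Prop :=
  ∃ v w, v ≠ w ∧ ¬ G.Adj v w ∧ Disjoint (G.neighborSet v) (G.neighborSet w) ∧
    G.neighborSet u = G.neighborSet v ∪ G.neighborSet w

/-- `u v x y` is a congruent (induced) quadrangle with congruent edges `uv`, `xy`. -/
def CongruentQuad (G : SimpleGraph V) (u v x y : V) : Prop :=
  u ≠ v ∧ u ≠ x ∧ u ≠ y ∧ v ≠ x ∧ v ≠ y ∧ x ≠ y ∧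
  G.Adj u v ∧ G.Adj v x ∧ G.Adj x y ∧ G.Adj y u ∧ ¬ G.Adj u x ∧ ¬ G.Adj v y ∧
  G.neighborSet u \ {y, v} = G.neighborSet v \ {u, x} ∧
  G.neighborSet x \ {v, y} = G.neighborSet y \ {x, u}

/-- A congruent vertex of III-type: a vertex of some congruent quadrangle. -/
def IIITypeVertex (G : SimpleGraph V) (z : V) : Prop :=
  ∃ u v x y, CongruentQuad G u v x y ∧ (z = u ∨ z = v ∨ z = x ∨ z = y)

/-- Membership in `𝒢_1^s(n)`: a connected graph obtained by adding a congruent vertex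
of I-type to some graph in `𝒢^{s-1}(n-1)`. -/
def memG1 {n : ℕ} (s : ℕ) (G : SimpleGraph (Fin n)) : Prop :=
  G.Connected ∧ ∃ v : Fin n, ITypeVertex G v ∧ memClass (s - 1) (G.induce {v}ᶜ)

/-- Membership in `𝒢_2^s(n)`. -/
def memG2 {n : ℕ} (s : ℕ) (G : SimpleGraph (Fin n)) : Prop :=
  G.Connected ∧ ∃ v : Fin n, IITypeVertex G v ∧ memClass (s - 1) (G.induce {v}ᶜ)

/-- Membership in `𝒢_3^s(n)`. -/
def memG3 {n : ℕ} (s : ℕ) (G : SimpleGraph (Fin n)) : Prop :=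
  G.Connected ∧ ∃ v : Fin n, IIITypeVertex G v ∧ memClass (s - 1) (G.induce {v}ᶜ)

/-- Oboudi's graph `G_m`: two cliques `K_{⌈m/2⌉}` (on `v_1, …`) and `K_{⌊m/2⌋}`
(on `w_1, …`), where `v_i ∼ w_j` iff `j ≥ ⌊m/2⌋ - i + 2` (1-indexed), i.e. (0-indexed)
`⌊m/2⌋ ≤ i + j`. -/
def oboudi (m : ℕ) : SimpleGraph (Fin ((m + 1) / 2) ⊕ Fin (m / 2)) :=
  SimpleGraph.fromRel fun a b =>
    match a, b with
    | Sum.inl _, Sum.inl _ => True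
    | Sum.inr _, Sum.inr _ => True
    | Sum.inl i, Sum.inr j => m / 2 ≤ (i : ℕ) + (j : ℕ)
    | Sum.inr _, Sum.inl _ => False

/-- The generalized lexicographic product `G[K_{t v}]`: each vertex `v` is replaced by a
clique of order `t v`, with complete joins along edges of `G`. -/
def lexProd (G : SimpleGraph V) (t : V → ℕ) : SimpleGraph (Σ v : V, Fin (t v)) :=
  SimpleGraph.fromRel fun a b => a.1 = b.1 ∨ G.Adj a.1 b.1

/-- Index conversion identifying the vertices `v_1, …, v_{⌈k/2⌉}, w_1, …, w_{⌊k/2⌋}`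
of `G_k` with `Fin k` (in this order). -/
def toIdx {k : ℕ} : Fin ((k + 1) / 2) ⊕ Fin (k / 2) → Fin k
  | Sum.inl i => ⟨(i : ℕ), by have := i.isLt; omega⟩
  | Sum.inr j => ⟨(k + 1) / 2 + (j : ℕ), by have := j.isLt; omega⟩

/-- `B_k(n_1, …, n_k) = G_k[K_{n_1}, …, K_{n_k}]`. -/
def bGraph (k : ℕ) (nn : Fin k → ℕ) :
    SimpleGraph (Σ v : Fin ((k + 1) / 2) ⊕ Fin (k / 2), Fin (nn (toIdx v))) :=
  lexProd (oboudi k) fun v => nn (toIdx v)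

/-- Membership in `𝓓* = {B_k(n_1,…,n_k) ∈ 𝓑_k^{00}(n) : 4 ≤ k ≤ 14, n ≤ 14}` (up to
isomorphism). -/
def memDstar {n : ℕ} (G : SimpleGraph (Fin n)) : Prop :=
  ∃ (k : ℕ) (nn : Fin k → ℕ), 4 ≤ k ∧ k ≤ 14 ∧ (∀ i, 1 ≤ nn i) ∧ (∑ i, nn i) ≤ 14 ∧
    lam (bGraph k nn) 3 = 0 ∧ lam (bGraph k nn) 4 = 0 ∧ Nonempty (G ≃g bGraph k nn)

/-- The degree of a vertex. -/
noncomputable def deg [Finite V] (G : SimpleGraph V) (v : V) : ℕ :=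
  Nat.card (G.neighborSet v)

/-- `v` is a vertex of minimum degree. -/
def IsMinDegVertex [Finite V] (G : SimpleGraph V) (v : V) : Prop :=
  ∀ w, deg G v ≤ deg G w

/-- The set `Y = V(G) ∖ N[v]`. -/
def Yset (G : SimpleGraph V) (v : V) : Set V :=
  (G.neighborSet v ∪ {v})ᶜ

/-- `G` is `X`-complete with respect to `v`: `G[Y] ≅ K_{n-t-1}` with `n-t-1 ≥ 2`
and `G[X]` is complete, where `X = N(v)`, `Y = V(G) ∖ N[v]`. -/
def IsXComplete [Finite V] (G : SimpleGraph V) (v : V) : Prop :=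
  2 ≤ (Yset G v).ncard ∧ (Yset G v).Pairwise G.Adj ∧ (G.neighborSet v).Pairwise G.Adj

/-- An `X`-complete graph is reduced when the traces on `Y` of the neighbourhoods of
vertices of `X` form a chain. -/
def IsReduced (G : SimpleGraph V) (v : V) : Prop :=
  ∀ x ∈ G.neighborSet v, ∀ x' ∈ G.neighborSet v,
    G.neighborSet x ∩ Yset G v ⊆ G.neighborSet x' ∩ Yset G v ∨
    G.neighborSet x' ∩ Yset G v ⊆ G.neighborSet x ∩ Yset G v

end TwoPosEig

open Matrix BigOperators
namespace TwoPosEig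
section spectral
variable {V : Type*} [Fintype V] [DecidableEq V]

lemma herm_form (A : Matrix V V ℝ) (hA : A.IsHermitian) (x : V → ℝ) :
    x ⬝ᵥ (A *ᵥ x) = ∑ i, hA.eigenvalues i *
      (((hA.eigenvectorUnitary : Matrix V V ℝ)ᵀ *ᵥ x) i) ^ 2 := by
  set P : Matrix V V ℝ := (hA.eigenvectorUnitary : Matrix V V ℝ) with hP
  have h : A = P * diagonal hA.eigenvalues * Pᵀ := by
    have := hA.spectral_theorem
    rw [Unitary.conjStarAlgAut_apply] at this
    conv_lhs => rw [this]
    rfl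
  have e : x ⬝ᵥ (A *ᵥ x) = (Pᵀ *ᵥ x) ⬝ᵥ (diagonal hA.eigenvalues *ᵥ (Pᵀ *ᵥ x)) := by
    conv_lhs => rw [h]
    rw [← Matrix.mulVec_mulVec, ← Matrix.mulVec_mulVec, Matrix.dotProduct_mulVec x P,
      ← Matrix.mulVec_transpose]
  rw [e, dotProduct]
  refine Finset.sum_congr rfl fun i _ => ?_
  rw [Matrix.mulVec_diagonal]; ring

lemma orth1 (A : Matrix V V ℝ) (hA : A.IsHermitian) :
    (hA.eigenvectorUnitary : Matrix V V ℝ)ᵀ * (hA.eigenvectorUnitary : Matrix V V ℝ) = 1 :=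
  (Matrix.mem_unitaryGroup_iff').1 hA.eigenvectorUnitary.2

lemma finrank_le_pos (A : Matrix V V ℝ) (hA : A.IsHermitian) {U : Type*} [AddCommGroup U]
    [Module ℝ U] (f : U →ₗ[ℝ] (V → ℝ))
    (hf : ∀ u, u ≠ 0 → 0 < f u ⬝ᵥ (A *ᵥ f u)) :
    Module.finrank ℝ U ≤ Nat.card {i // 0 < hA.eigenvalues i} := by
  classical
  let g : U →ₗ[ℝ] ({i // 0 < hA.eigenvalues i} → ℝ) :=
    (LinearMap.funLeft ℝ ℝ (Subtype.val : {i // 0 < hA.eigenvalues i} → V)) ∘ₗ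
      ((hA.eigenvectorUnitary : Matrix V V ℝ)ᵀ.mulVecLin) ∘ₗ f
  have hg : Function.Injective g := by
    rw [injective_iff_map_eq_zero]
    intro u hu
    by_contra hne
    have := hf u hne
    rw [herm_form A hA] at this
    refine absurd this (not_lt.2 (Finset.sum_nonpos fun i _ => ?_))
    by_cases hi : 0 < hA.eigenvalues i
    · have : (((hA.eigenvectorUnitary : Matrix V V ℝ)ᵀ *ᵥ f u) i) = 0 := congrFun hu ⟨i, hi⟩
      rw [this]; simp
    · exact mul_nonpos_of_nonpos_of_nonneg (not_lt.1 hi) (sq_nonneg _)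
  have := LinearMap.finrank_le_finrank_of_injective hg
  simpa [Nat.card_eq_fintype_card] using this

lemma exists_pos (A : Matrix V V ℝ) (hA : A.IsHermitian) :
    ∃ f : (Fin (Nat.card {i // 0 < hA.eigenvalues i}) → ℝ) →ₗ[ℝ] (V → ℝ),
      ∀ u, u ≠ 0 → 0 < f u ⬝ᵥ (A *ᵥ f u) := by
  classical
  let ι := {i // 0 < hA.eigenvalues i}
  let e : Fin (Nat.card ι) ≃ ι := (Finite.equivFin ι).symm
  let ext : (Fin (Nat.card ι) → ℝ) →ₗ[ℝ] (V → ℝ) :=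
    { toFun := fun u v => if h : 0 < hA.eigenvalues v then u (e.symm ⟨v, h⟩) else 0
      map_add' := by intro a b; ext v; by_cases h : 0 < hA.eigenvalues v <;> simp [h]
      map_smul' := by intro a b; ext v; by_cases h : 0 < hA.eigenvalues v <;> simp [h] }
  refine ⟨((hA.eigenvectorUnitary : Matrix V V ℝ).mulVecLin) ∘ₗ ext, fun u hu => ?_⟩
  rw [herm_form A hA]
  have : ∀ i, ((hA.eigenvectorUnitary : Matrix V V ℝ)ᵀ *ᵥ
      ((((hA.eigenvectorUnitary : Matrix V V ℝ).mulVecLin) ∘ₗ ext) u)) i = ext u i := by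
    intro i
    simp only [LinearMap.comp_apply, Matrix.mulVecLin_apply, Matrix.mulVec_mulVec, orth1,
      Matrix.one_mulVec]
  simp only [this]
  obtain ⟨j, hj⟩ : ∃ j, u j ≠ 0 := by
    by_contra hh; push Not at hh; exact hu (funext hh)
  refine Finset.sum_pos' (fun i _ => ?_) ⟨(e j).1, Finset.mem_univ _, ?_⟩
  · by_cases h : 0 < hA.eigenvalues i
    · positivity
    · simp [ext, h]
  · have h := (e j).2
    have : ext u (e j).1 = u j := by simp [ext, h]
    rw [this]; positivity

lemma null_card (A : Matrix V V ℝ) (hA : A.IsHermitian) :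
    Nat.card {i // hA.eigenvalues i = 0} + A.rank = Fintype.card V := by
  classical
  rw [hA.rank_eq_card_non_zero_eigs, Nat.card_eq_fintype_card]
  have := Fintype.card_subtype_compl (fun i => hA.eigenvalues i = 0)
  have h2 := Fintype.card_subtype_le (fun i => hA.eigenvalues i = 0)
  simp only [ne_eq]
  omega

lemma posCount_eq (G : SimpleGraph V) :
    posCount G = Nat.card {i // 0 < (adjMat_isHermitian G).eigenvalues i} := by
  unfold posCount eigs
  congr!

lemma nullCount_eq (G : SimpleGraph V) :
    nullCount G = Nat.card {i // (adjMat_isHermitian G).eigenvalues i = 0} := by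
  unfold nullCount eigs
  congr!

lemma finrank_le_posCount (G : SimpleGraph V) {U : Type*} [AddCommGroup U]
    [Module ℝ U] (f : U →ₗ[ℝ] (V → ℝ))
    (hf : ∀ u, u ≠ 0 → 0 < f u ⬝ᵥ (adjMat G *ᵥ f u)) :
    Module.finrank ℝ U ≤ posCount G := by
  rw [posCount_eq]; exact finrank_le_pos _ _ f hf

lemma exists_posCount (G : SimpleGraph V) :
    ∃ f : (Fin (posCount G) → ℝ) →ₗ[ℝ] (V → ℝ),
      ∀ u, u ≠ 0 → 0 < f u ⬝ᵥ (adjMat G *ᵥ f u) := by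
  rw [posCount_eq]; exact exists_pos _ _

lemma nullCount_add_rank (G : SimpleGraph V) :
    nullCount G + (adjMat G).rank = Fintype.card V := by
  rw [nullCount_eq]; exact null_card _ _

lemma nullCount_eq_finrank (G : SimpleGraph V) :
    nullCount G = Module.finrank ℝ (LinearMap.ker (adjMat G).mulVecLin) := by
  have h1 := nullCount_add_rank G
  have h2 := LinearMap.finrank_range_add_finrank_ker (adjMat G).mulVecLin
  rw [Module.finrank_fintype_fun_eq_card] at h2
  unfold Matrix.rank at h1
  omega

lemma adjMat_apply (G : SimpleGraph V) (u v : V) [Decidable (G.Adj u v)] :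
    adjMat G u v = if G.Adj u v then 1 else 0 := by
  unfold adjMat; simp [SimpleGraph.adjMatrix_apply]

lemma adjMat_symm (G : SimpleGraph V) (u v : V) : adjMat G u v = adjMat G v u := by
  classical
  simp [adjMat_apply, G.adj_comm]

lemma adjMat_transpose (G : SimpleGraph V) : (adjMat G)ᵀ = adjMat G := by
  ext u v; exact adjMat_symm G v u

lemma adjMat_mulVec (G : SimpleGraph V) (x : V → ℝ) (v : V) [DecidableRel G.Adj] :
    (adjMat G *ᵥ x) v = ∑ w, if G.Adj v w then x w else 0 := by
  simp only [Matrix.mulVec, dotProduct, adjMat_apply]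
  refine Finset.sum_congr rfl fun w _ => ?_
  split_ifs <;> simp

variable {W : Type*} [Fintype W] [DecidableEq W]

/-- pulling back a form does not increase the inertia indices -/
lemma posCount_le_of_congr (G : SimpleGraph V) (H : SimpleGraph W) (P : Matrix W V ℝ)
    (h : adjMat G = Pᵀ * adjMat H * P) : posCount G ≤ posCount H := by
  obtain ⟨f, hf⟩ := exists_posCount G
  have := finrank_le_posCount H (P.mulVecLin ∘ₗ f) (by
    intro u hu
    have := hf u hu
    rw [h, ← Matrix.mulVec_mulVec, ← Matrix.mulVec_mulVec, Matrix.dotProduct_mulVec,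
      Matrix.vecMul_transpose] at this
    simpa using this)
  simpa using this

lemma rank_le_of_congr (G : SimpleGraph V) (H : SimpleGraph W) (P : Matrix W V ℝ)
    (h : adjMat G = Pᵀ * adjMat H * P) : (adjMat G).rank ≤ (adjMat H).rank := by
  rw [h, Matrix.mul_assoc]
  exact (Matrix.rank_mul_le_right _ _).trans (Matrix.rank_mul_le_left _ _)

lemma iso_mat (G : SimpleGraph V) (H : SimpleGraph W) (e : G ≃g H) :
    adjMat G = (Matrix.of fun (w : W) (v : V) => if w = e v then (1:ℝ) else 0)ᵀ *
        adjMat H * (Matrix.of fun (w : W) (v : V) => if w = e v then (1:ℝ) else 0) := by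
  classical
  ext u v
  simp only [Matrix.mul_apply, adjMat_apply, Matrix.of_apply, Matrix.transpose_apply, mul_ite,
    mul_one, mul_zero, Finset.sum_ite_eq', Finset.mem_univ, if_true]
  rw [Finset.sum_eq_single (e u)]
  · simp [e.map_adj_iff]
  · intro b _ hb; simp [hb]
  · simp

lemma iso_congr (G : SimpleGraph V) (H : SimpleGraph W) (e : G ≃g H) :
    posCount G = posCount H ∧ nullCount G = nullCount H := by
  classical
  have key2 := iso_mat G H e
  have key3 := iso_mat H G e.symm
  refine ⟨le_antisymm (posCount_le_of_congr _ _ _ key2) (posCount_le_of_congr _ _ _ key3), ?_⟩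
  have hr := le_antisymm (rank_le_of_congr _ _ _ key2) (rank_le_of_congr _ _ _ key3)
  have h1 := nullCount_add_rank G
  have h2 := nullCount_add_rank H
  have h3 := Fintype.card_congr e.toEquiv
  omega
end spectral
end TwoPosEig

open Matrix BigOperators
namespace TwoPosEig
section structure1
variable {V : Type*} [Fintype V] [DecidableEq V]

lemma sum_compl_singleton (u : V) (f : V → ℝ) [Fintype ↥({u}ᶜ : Set V)] :
    ∑ i : ↥({u}ᶜ : Set V), f i = ∑ i ∈ Finset.univ.erase u, f i := by
  symm
  apply Finset.sum_subtype
  simp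

lemma row_dep (G : SimpleGraph V) (u : V) (a : V → ℝ) (ha : a u = 0)
    (h : ∀ z, adjMat G u z = ∑ i, a i * adjMat G i z) :
    posCount G = posCount (G.induce {u}ᶜ) ∧ nullCount G = nullCount (G.induce {u}ᶜ) + 1 := by
  classical
  let P : Matrix ↥({u}ᶜ : Set V) V ℝ := Matrix.of fun i v =>
    (if (i : V) = v then 1 else 0) + (if v = u then a i else 0)
  let Q : Matrix V ↥({u}ᶜ : Set V) ℝ := Matrix.of fun v i => if v = (i : V) then 1 else 0
  have hA : ∀ i j : ↥({u}ᶜ : Set V), adjMat (G.induce {u}ᶜ) i j = adjMat G i j := by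
    intro i j; simp [adjMat_apply]
  have c1 : ∀ v j, ∑ i : ↥({u}ᶜ : Set V), P i v * adjMat G i j = adjMat G v j := by
    intro v j
    refine (sum_compl_singleton u (fun i => ((if (i : V) = v then 1 else 0) +
      (if v = u then a i else 0)) * adjMat G i j)).trans ?_
    by_cases hv : v = u
    · subst hv
      simp only [if_true]
      rw [h, ← Finset.sum_erase_add _ _ (Finset.mem_univ v), ha, zero_mul, add_zero]
      refine Finset.sum_congr rfl fun i hi => ?_
      rw [if_neg (Finset.ne_of_mem_erase hi)]; ring
    · simp only [if_neg hv, add_zero]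
      rw [Finset.sum_eq_single v]
      · simp
      · intro b _ hb; simp [hb]
      · intro hh; simp [hv] at hh
  have hP : adjMat G = Pᵀ * adjMat (G.induce {u}ᶜ) * P := by
    ext v w
    simp only [Matrix.mul_apply, Matrix.transpose_apply, hA, c1]
    simp_rw [mul_comm (adjMat G v _), adjMat_symm G v]
    rw [c1 w v]
  have hQ : adjMat (G.induce {u}ᶜ) = Qᵀ * adjMat G * Q := by
    ext v w
    simp [Matrix.mul_apply, hA, Q]
  refine ⟨le_antisymm (posCount_le_of_congr _ _ _ hP) (posCount_le_of_congr _ _ _ hQ), ?_⟩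
  have hr := le_antisymm (rank_le_of_congr _ _ _ hP) (rank_le_of_congr _ _ _ hQ)
  have h1 := nullCount_add_rank G
  have h2 := nullCount_add_rank (G.induce {u}ᶜ)
  have h3 : Fintype.card V = Fintype.card ↥({u}ᶜ : Set V) + 1 := by
    rw [Fintype.card_compl_set]
    have : 0 < Fintype.card V := Fintype.card_pos_iff.2 ⟨u⟩
    simp; omega
  omega

lemma form_lower (G : SimpleGraph V) (y : V → ℝ) :
    -(Fintype.card V : ℝ) * (y ⬝ᵥ y) ≤ y ⬝ᵥ (adjMat G *ᵥ y) := by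
  classical
  have h1 : y ⬝ᵥ (adjMat G *ᵥ y) = ∑ i, ∑ j, adjMat G i j * (y i * y j) := by
    simp only [dotProduct, Matrix.mulVec, Finset.mul_sum]
    refine Finset.sum_congr rfl fun i _ => Finset.sum_congr rfl fun j _ => by ring
  have h2 : -(Fintype.card V : ℝ) * (y ⬝ᵥ y) = ∑ i, ∑ j, -((y i ^ 2 + y j ^ 2) / 2) := by
    simp only [Finset.sum_neg_distrib, ← Finset.sum_div, Finset.sum_add_distrib,
      Finset.sum_const, Finset.card_univ, nsmul_eq_mul, dotProduct, ← Finset.mul_sum]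
    have : ∑ i, y i * y i = ∑ i, y i ^ 2 := Finset.sum_congr rfl fun i _ => by ring
    rw [this]; ring
  rw [h1, h2]
  refine Finset.sum_le_sum fun i _ => Finset.sum_le_sum fun j _ => ?_
  rw [adjMat_apply]
  split_ifs
  · nlinarith [sq_nonneg (y i + y j)]
  · nlinarith [sq_nonneg (y i), sq_nonneg (y j)]

lemma dot_symm (G : SimpleGraph V) (x y : V → ℝ) :
    x ⬝ᵥ (adjMat G *ᵥ y) = (adjMat G *ᵥ x) ⬝ᵥ y := by
  rw [Matrix.dotProduct_mulVec, ← Matrix.mulVec_transpose, adjMat_transpose]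

lemma isotropic3 (G : SimpleGraph V) (hp : posCount G ≤ 2) (X : Fin 3 → V → ℝ)
    (h : ∀ i j, X i ⬝ᵥ (adjMat G *ᵥ X j) = 0) :
    ∃ a : Fin 3 → ℝ, a ≠ 0 ∧ ∀ z, a 0 * (adjMat G *ᵥ X 0) z + a 1 * (adjMat G *ᵥ X 1) z
      + a 2 * (adjMat G *ᵥ X 2) z = 0 := by
  classical
  by_contra hcon
  push Not at hcon
  let g : (Fin 3 → ℝ) →ₗ[ℝ] (V → ℝ) := Fintype.linearCombination ℝ X
  have hg : ∀ a, g a = a 0 • X 0 + a 1 • X 1 + a 2 • X 2 := by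
    intro a; simp [g, Fintype.linearCombination_apply, Fin.sum_univ_three]
  let δ : ℝ := 1 / (Fintype.card V + 1)
  have hδ : 0 < δ := by positivity
  let f : (Fin 3 → ℝ) →ₗ[ℝ] (V → ℝ) := g + δ • ((adjMat G).mulVecLin ∘ₗ g)
  have hf : ∀ u, u ≠ 0 → 0 < f u ⬝ᵥ (adjMat G *ᵥ f u) := by
    intro u hu
    obtain ⟨z, hz⟩ := hcon u hu
    set r := adjMat G *ᵥ g u with hr
    have e0 : g u ⬝ᵥ r = 0 := by
      rw [hr, hg]
      simp only [Matrix.mulVec_add, Matrix.mulVec_smul, dotProduct_add, add_dotProduct,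
        smul_dotProduct, dotProduct_smul, h]; simp
    have hrz : r z ≠ 0 := by
      rw [hr, hg]
      simpa only [Matrix.mulVec_add, Matrix.mulVec_smul, Pi.add_apply, Pi.smul_apply,
        smul_eq_mul] using hz
    have hrr : 0 < r ⬝ᵥ r := by
      unfold dotProduct
      refine Finset.sum_pos' (fun i _ => mul_self_nonneg _) ⟨z, Finset.mem_univ _, ?_⟩
      exact mul_self_pos.2 hrz
    have hfu : f u = g u + δ • r := by simp [f, hr]
    have e1 : f u ⬝ᵥ (adjMat G *ᵥ f u) = 2 * δ * (r ⬝ᵥ r) + δ ^ 2 * (r ⬝ᵥ (adjMat G *ᵥ r)) := by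
      rw [hfu]
      simp only [Matrix.mulVec_add, Matrix.mulVec_smul, dotProduct_add, add_dotProduct,
        smul_dotProduct, dotProduct_smul, smul_eq_mul]
      rw [dot_symm G (g u) r, ← hr, e0]; ring
    rw [e1]
    have h1 := form_lower G r
    have h2 : δ * (Fintype.card V + 1) = 1 := by
      simp only [δ]; field_simp
    have h3 : δ ^ 2 * (r ⬝ᵥ (adjMat G *ᵥ r)) ≥ δ ^ 2 * (-(Fintype.card V : ℝ) * (r ⬝ᵥ r)) :=
      mul_le_mul_of_nonneg_left h1 (by positivity)
    have h4 : δ ^ 2 * (-(Fintype.card V : ℝ) * (r ⬝ᵥ r)) = - δ * (1 - δ) * (r ⬝ᵥ r) := by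
      have : δ * Fintype.card V = 1 - δ := by linarith
      calc _ = - δ * (δ * Fintype.card V) * (r ⬝ᵥ r) := by ring
        _ = _ := by rw [this]
    nlinarith [mul_pos hδ hrr, mul_pos (pow_pos hδ 2) hrr]
  have := finrank_le_posCount G f hf
  simp at this
  omega
end structure1
end TwoPosEig

open Matrix BigOperators
namespace TwoPosEig
section structure2
variable {V : Type*} [Fintype V] [DecidableEq V]

lemma ker_dep (G : SimpleGraph V) (u : V) (b : V → ℝ) (hu : b u ≠ 0)
    (h : ∀ z, (adjMat G *ᵥ b) z = 0) (s : ℕ) (hs : 1 ≤ s) :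
    memClass s G ↔ memClass (s - 1) (G.induce {u}ᶜ) := by
  obtain ⟨h1, h2⟩ := row_dep G u (fun i => if i = u then 0 else - (b i / b u)) (by simp) (by
    intro z
    have hz := h z
    rw [Matrix.mulVec, dotProduct, ← Finset.add_sum_erase _ _ (Finset.mem_univ u)] at hz
    rw [← Finset.add_sum_erase _ _ (Finset.mem_univ u)]
    have : ∑ x ∈ Finset.univ.erase u, (if x = u then 0 else - (b x / b u)) * adjMat G x z
        = - (∑ x ∈ Finset.univ.erase u, adjMat G z x * b x) / b u := by
      rw [neg_div, Finset.sum_div, ← Finset.sum_neg_distrib]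
      refine Finset.sum_congr rfl fun x hx => ?_
      rw [if_neg (Finset.ne_of_mem_erase hx), adjMat_symm G x z]; ring
    rw [this, adjMat_symm G u z]
    simp only [if_true, zero_mul, zero_add]
    field_simp
    linarith)
  unfold memClass
  rw [h1, h2]
  constructor
  · rintro ⟨h, h'⟩; exact ⟨h, by omega⟩
  · rintro ⟨h, h'⟩; exact ⟨h, by omega⟩

lemma mulVec_single' (G : SimpleGraph V) (i z : V) :
    (adjMat G *ᵥ (Pi.single i (1:ℝ))) z = adjMat G z i := by
  simp

lemma memClass_I (G : SimpleGraph V) (v : V) (h : ITypeVertex G v) (s : ℕ) (hs : 1 ≤ s) :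
    memClass s G ↔ memClass (s - 1) (G.induce {v}ᶜ) := by
  classical
  obtain ⟨u, huv, -, hN⟩ := h
  refine ker_dep G v (Pi.single u 1 - Pi.single v 1) (by simp [huv.symm]) ?_ s hs
  intro z
  rw [Matrix.mulVec_sub, Pi.sub_apply, mulVec_single', mulVec_single', adjMat_apply, adjMat_apply]
  have : G.Adj z u ↔ G.Adj z v := by
    have := Set.ext_iff.1 hN z
    simpa [G.adj_comm] using this
  simp [this]

lemma memClass_II (G : SimpleGraph V) (hne : ∀ v, ∃ w, G.Adj v w) (u : V)
    (h : IITypeVertex G u) (s : ℕ) (hs : 1 ≤ s) :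
    memClass s G ↔ memClass (s - 1) (G.induce {u}ᶜ) := by
  classical
  obtain ⟨v, w, hvw, -, hd, hN⟩ := h
  rw [Set.disjoint_left] at hd
  have hN' : ∀ z, G.Adj u z ↔ G.Adj v z ∨ G.Adj w z := fun z => by
    simpa using Set.ext_iff.1 hN z
  have hd' : ∀ z, G.Adj v z → ¬ G.Adj w z := fun z => by simpa using @hd z
  have huv : u ≠ v := by
    rintro rfl
    obtain ⟨z, hz⟩ := hne w
    exact hd' z ((hN' z).2 (Or.inr hz)) hz
  have huw : u ≠ w := by
    rintro rfl
    obtain ⟨z, hz⟩ := hne v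
    exact hd' z hz ((hN' z).2 (Or.inl hz))
  refine ker_dep G u (Pi.single v 1 + Pi.single w 1 - Pi.single u 1) (by simp [huv, huw]) ?_ s hs
  intro z
  rw [Matrix.mulVec_sub, Pi.sub_apply, Matrix.mulVec_add, Pi.add_apply, mulVec_single',
    mulVec_single', mulVec_single', adjMat_symm G z, adjMat_symm G z, adjMat_symm G z,
    adjMat_apply, adjMat_apply, adjMat_apply]
  have h1 := hN' z
  have h2 := hd' z
  by_cases a : G.Adj v z <;> by_cases b : G.Adj w z <;> simp_all

lemma memClass_III (G : SimpleGraph V) (t : V)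
    (h : IIITypeVertex G t) (s : ℕ) (hs : 1 ≤ s) :
    memClass s G ↔ memClass (s - 1) (G.induce {t}ᶜ) := by
  classical
  obtain ⟨u, v, x, y, ⟨huv, hux, huy, hvx, hvy, hxy, auv, avx, axy, ayu, nux, nvy, e1, e2⟩, ht⟩ := h
  refine ker_dep G t (Pi.single u 1 - Pi.single v 1 - Pi.single x 1 + Pi.single y 1) ?_ ?_ s hs
  · rcases ht with rfl | rfl | rfl | rfl <;> simp [*, Ne.symm]
  · intro z
    simp only [Matrix.mulVec_sub, Pi.sub_apply, Matrix.mulVec_add, Pi.add_apply, mulVec_single',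
      adjMat_symm G z, adjMat_apply]
    have f1 := Set.ext_iff.1 e1 z
    have f2 := Set.ext_iff.1 e2 z
    simp only [Set.mem_sdiff, SimpleGraph.mem_neighborSet, Set.mem_insert_iff,
      Set.mem_singleton_iff, not_or] at f1 f2
    by_cases zu : z = u
    · subst zu; simp [auv, auv.symm, nux, ayu, G.adj_comm x]
    by_cases zv : z = v
    · subst zv; simp [auv, avx.symm, nvy, G.adj_comm y]
    by_cases zx : z = x
    · subst zx; simp [nux, avx, axy.symm]
    by_cases zy : z = y
    · subst zy; simp [ayu.symm, nvy, axy]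
    simp only [zu, zv, zx, zy, not_false_eq_true, and_self, and_true] at f1 f2
    simp [f1, f2]

lemma pred2 (P Q : V → Prop) (hP : ∃ z, P z) (hQ : ∃ z, Q z) (a b : ℝ) (hab : a ≠ 0 ∨ b ≠ 0)
    [DecidablePred P] [DecidablePred Q]
    (h : ∀ z, a * (if P z then 1 else 0) + b * (if Q z then 1 else 0) = 0) : ∀ z, P z ↔ Q z := by
  have ha : a ≠ 0 := by
    rintro rfl
    obtain ⟨z, hz⟩ := hQ
    have := h z
    simp [hz] at this; simp [this] at hab
  have hb : b ≠ 0 := by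
    rintro rfl
    obtain ⟨z, hz⟩ := hP
    have := h z
    simp [hz] at this; simp [this] at ha
  intro z
  have := h z
  by_cases h1 : P z <;> by_cases h2 : Q z <;> simp_all

lemma pred3 (P Q R : V → Prop) (hP : ∃ z, P z) (hQ : ∃ z, Q z) (hR : ∃ z, R z) (a b c : ℝ)
    (hab : ¬ (a = 0 ∧ b = 0 ∧ c = 0))
    [DecidablePred P] [DecidablePred Q] [DecidablePred R]
    (h : ∀ z, a * (if P z then 1 else 0) + b * (if Q z then 1 else 0)
      + c * (if R z then 1 else 0) = 0) :
    (∀ z, P z ↔ Q z) ∨ (∀ z, P z ↔ R z) ∨ (∀ z, Q z ↔ R z) ∨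
    (∀ z, (P z ↔ Q z ∨ R z) ∧ ¬ (Q z ∧ R z)) ∨ (∀ z, (Q z ↔ P z ∨ R z) ∧ ¬ (P z ∧ R z)) ∨
    (∀ z, (R z ↔ P z ∨ Q z) ∧ ¬ (P z ∧ Q z)) := by
  by_cases ha : a = 0
  · refine Or.inr (Or.inr (Or.inl (pred2 Q R hQ hR b c ?_ (by simpa [ha] using h))))
    by_contra hh; push Not at hh; exact hab ⟨ha, hh⟩
  by_cases hb : b = 0
  · refine Or.inr (Or.inl (pred2 P R hP hR a c (Or.inl ha) (by simpa [hb] using h)))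
  by_cases hc : c = 0
  · refine (Or.inl (pred2 P Q hP hQ a b (Or.inl ha) (by simpa [hc] using h)))
  by_cases h3 : ∃ z, P z ∧ Q z ∧ R z
  · left
    obtain ⟨z, h1, h2, h3⟩ := h3
    have e := h z
    simp [h1, h2, h3] at e
    intro w
    have f := h w
    by_cases h4 : P w <;> by_cases h5 : Q w <;> by_cases h6 : R w <;> simp [h4, h5, h6] at f ⊢
    · exact hb (by linarith)
    · exact ha f
    · exact ha (by linarith)
    · exact hb f
  push Not at h3
  by_cases k1 : ∃ z, P z ∧ Q z
  · by_cases k2 : ∃ z, P z ∧ R z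
    · by_cases k3 : ∃ z, Q z ∧ R z
      · exfalso
        obtain ⟨z, p1, p2⟩ := k1
        obtain ⟨w, q1, q2⟩ := k2
        obtain ⟨t, r1, r2⟩ := k3
        have e1 := h z
        have e2 := h w
        have e3 := h t
        have p3 := h3 z p1 p2
        have q3 : ¬ Q w := fun hh => h3 w q1 hh q2
        have r3 : ¬ P t := fun hh => h3 t hh r1 r2
        simp [*] at e1 e2 e3
        exact ha (by linarith)
      · push Not at k3
        refine Or.inr (Or.inr (Or.inr (Or.inl fun w => ?_)))
        have f := h w
        have := k3 w
        by_cases h4 : P w <;> by_cases h5 : Q w <;> by_cases h6 : R w <;> simp_all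
    · push Not at k2
      refine Or.inr (Or.inr (Or.inr (Or.inr (Or.inl fun w => ?_))))
      have f := h w
      have := k2 w
      by_cases h4 : P w <;> by_cases h5 : Q w <;> by_cases h6 : R w <;> simp_all
  · push Not at k1
    refine Or.inr (Or.inr (Or.inr (Or.inr (Or.inr fun w => ?_))))
    have f := h w
    have := k1 w
    by_cases h4 : P w <;> by_cases h5 : Q w <;> by_cases h6 : R w <;> simp_all

/-- no congruent vertices -/
def NoCong (G : SimpleGraph V) : Prop :=
  ∀ v, ¬ ITypeVertex G v ∧ ¬ IITypeVertex G v ∧ ¬ IIITypeVertex G v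

lemma no_indep3 (G : SimpleGraph V) (hne : ∀ v, ∃ w, G.Adj v w) (hp : posCount G ≤ 2)
    (hc : NoCong G) (a b c : V) (hab : a ≠ b) (hac : a ≠ c) (hbc : b ≠ c)
    (nab : ¬ G.Adj a b) (nac : ¬ G.Adj a c) (nbc : ¬ G.Adj b c) : False := by
  classical
  have nba : ¬ G.Adj b a := fun h => nab h.symm
  have nca : ¬ G.Adj c a := fun h => nac h.symm
  have ncb : ¬ G.Adj c b := fun h => nbc h.symm
  obtain ⟨α, hα, h⟩ := isotropic3 G hp
    ![Pi.single a (1:ℝ), Pi.single b (1:ℝ), Pi.single c (1:ℝ)] (by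
      intro i j
      fin_cases i <;> fin_cases j <;>
        simp [adjMat_apply, nab, nac, nbc, nba, nca, ncb])
  have hα' : ¬ (α 0 = 0 ∧ α 1 = 0 ∧ α 2 = 0) := by
    rintro ⟨h0, h1, h2⟩
    exact hα (by ext i; fin_cases i <;> assumption)
  have key := pred3 (G.Adj a) (G.Adj b) (G.Adj c) (hne a) (hne b) (hne c) _ _ _ hα' (by
    intro z
    have := h z
    simpa [adjMat_symm G z, adjMat_apply] using this)
  have e1 : ∀ x y, x ≠ y → ¬ G.Adj x y → (∀ z, G.Adj x z ↔ G.Adj y z) → False := by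
    intro x y hxy nxy hh
    exact (hc y).1 ⟨x, hxy, nxy, by ext z; simpa using hh z⟩
  have e2 : ∀ x y z, y ≠ z → ¬ G.Adj y z →
      (∀ w, (G.Adj x w ↔ G.Adj y w ∨ G.Adj z w) ∧ ¬ (G.Adj y w ∧ G.Adj z w)) → False := by
    intro x y z hyz nyz hh
    refine (hc x).2.1 ⟨y, z, hyz, nyz, ?_, ?_⟩
    · rw [Set.disjoint_left]; intro w h1 h2; exact (hh w).2 ⟨h1, h2⟩
    · ext w; simpa using (hh w).1
  rcases key with k | k | k | k | k | k
  · exact e1 a b hab nab k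
  · exact e1 a c hac nac k
  · exact e1 b c hbc nbc k
  · exact e2 _ _ _ hbc nbc k
  · exact e2 _ _ _ hac nac k
  · exact e2 _ _ _ hab nab k

lemma sign_aux (t : ℝ) (ht : t ≠ 0) (a b c d : Prop) [Decidable a] [Decidable b] [Decidable c]
    [Decidable d] (h : t * (if a then 1 else 0) + -t * (if b then 1 else 0) +
      t * ((if c then 1 else 0) - (if d then 1 else 0)) = 0)
    (n1 : a → b → c ∨ d) (n2 : c → d → a ∨ b) : (a ↔ d) ∧ (b ↔ c) := by
  have h2 : t + t ≠ 0 := by intro h; apply ht; linarith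
  by_cases k1 : a <;> by_cases k2 : b <;> by_cases k3 : c <;> by_cases k4 : d <;>
    simp [k1, k2, k3, k4, ht] at h n1 n2 ⊢ <;> exact ht (by linarith)

lemma no_C4 (G : SimpleGraph V) (hne : ∀ v, ∃ w, G.Adj v w) (hp : posCount G ≤ 2)
    (hc : NoCong G) (u v x y : V) (hux : u ≠ x) (hvy : v ≠ y)
    (auv : G.Adj u v) (avx : G.Adj v x) (axy : G.Adj x y) (ayu : G.Adj y u)
    (nux : ¬ G.Adj u x) (nvy : ¬ G.Adj v y) : False := by
  classical
  have nxu : ¬ G.Adj x u := fun h => nux h.symm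
  have nyv : ¬ G.Adj y v := fun h => nvy h.symm
  -- first the relation
  obtain ⟨α, hα, h⟩ := isotropic3 G hp
    ![Pi.single u (1:ℝ), Pi.single x (1:ℝ), Pi.single v (1:ℝ) - Pi.single y (1:ℝ)] (by
      intro i j
      fin_cases i <;> fin_cases j <;>
        simp [Matrix.mulVec_sub, adjMat_apply, *, G.adj_comm, auv.symm, avx.symm, axy.symm, ayu.symm])
  have h' : ∀ z, α 0 * (if G.Adj u z then 1 else 0) + α 1 * (if G.Adj x z then 1 else 0)
      + α 2 * ((if G.Adj v z then 1 else 0) - (if G.Adj y z then 1 else 0)) = 0 := by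
    intro z
    have := h z
    simpa [Matrix.mulVec_sub, adjMat_symm G z, adjMat_apply] using this
  have hα' : ¬ (α 0 = 0 ∧ α 1 = 0 ∧ α 2 = 0) := by
    rintro ⟨h0, h1, h2⟩
    exact hα (by ext i; fin_cases i <;> assumption)
  have hv := h' v
  simp [auv, avx.symm, nyv] at hv
  have e1 : ∀ x y, x ≠ y → ¬ G.Adj x y → (∀ z, G.Adj x z ↔ G.Adj y z) → False := by
    intro x y hxy nxy hh
    exact (hc y).1 ⟨x, hxy, nxy, by ext z; simpa using hh z⟩
  have h2 : α 2 ≠ 0 := by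
    intro h2
    refine e1 u x hux nux fun z => ?_
    have := h' z
    have h0 : α 0 ≠ 0 := fun h0 => hα' ⟨h0, by linarith, h2⟩
    have h1 : α 1 ≠ 0 := fun h0 => hα' ⟨by linarith, h0, h2⟩
    by_cases k1 : G.Adj u z <;> by_cases k2 : G.Adj x z <;> simp_all
  have h0 : α 0 ≠ 0 := by
    intro h0
    refine e1 v y hvy nvy fun z => ?_
    have := h' z
    have h1 : α 1 = 0 := by linarith
    by_cases k1 : G.Adj v z <;> by_cases k2 : G.Adj y z <;> simp_all
  have h1 : α 1 = - α 0 := by linarith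
  -- no vertex splits u,x from v,y
  have no1 : ∀ z, G.Adj u z → G.Adj x z → G.Adj v z ∨ G.Adj y z ∨ z = v ∨ z = y := by
    intro z k1 k2
    by_contra hh
    push Not at hh
    exact no_indep3 G hne hp hc z v y hh.2.2.1 hh.2.2.2 hvy (fun h => hh.1 h.symm)
      (fun h => hh.2.1 h.symm) nvy
  have no2 : ∀ z, G.Adj v z → G.Adj y z → G.Adj u z ∨ G.Adj x z ∨ z = u ∨ z = x := by
    intro z k1 k2
    by_contra hh
    push Not at hh
    exact no_indep3 G hne hp hc z u x hh.2.2.1 hh.2.2.2 hux (fun h => hh.1 h.symm)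
      (fun h => hh.2.1 h.symm) nux
  -- pointwise: u - x = t (v - y)
  have hquad : ∀ p q, ((p = v ∧ q = y) ∨ (p = y ∧ q = v)) →
      (∀ z, z ≠ u → z ≠ p → z ≠ x → z ≠ q →
        ((G.Adj u z ↔ G.Adj p z) ∧ (G.Adj x z ↔ G.Adj q z))) → False := by
    rintro p q hpq hh
    have aup : G.Adj u p := by rcases hpq with ⟨rfl, rfl⟩ | ⟨rfl, rfl⟩; exacts [auv, ayu.symm]
    have apx : G.Adj p x := by rcases hpq with ⟨rfl, rfl⟩ | ⟨rfl, rfl⟩; exacts [avx, axy.symm]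
    have axq : G.Adj x q := by rcases hpq with ⟨rfl, rfl⟩ | ⟨rfl, rfl⟩; exacts [axy, avx.symm]
    have aqu : G.Adj q u := by rcases hpq with ⟨rfl, rfl⟩ | ⟨rfl, rfl⟩; exacts [ayu, auv.symm]
    have npq : ¬ G.Adj p q := by rcases hpq with ⟨rfl, rfl⟩ | ⟨rfl, rfl⟩; exacts [nvy, nyv]
    have dpq : p ≠ q := by rcases hpq with ⟨rfl, rfl⟩ | ⟨rfl, rfl⟩; exacts [hvy, hvy.symm]
    refine (hc u).2.2 ⟨u, p, x, q, ⟨aup.ne, hux, aqu.ne', apx.ne, dpq, axq.ne, aup, apx, axq, aqu,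
      nux, npq, ?_, ?_⟩, Or.inl rfl⟩
    · ext z
      simp only [Set.mem_sdiff, SimpleGraph.mem_neighborSet, Set.mem_insert_iff,
        Set.mem_singleton_iff, not_or]
      by_cases zu : z = u
      · subst zu; simp
      by_cases zv : z = p
      · subst zv; simp
      by_cases zx : z = x
      · subst zx; simp [nux]
      by_cases zy : z = q
      · subst zy; simp [npq]
      have := hh z zu zv zx zy
      simp [this, zu, zv, zx, zy]
    · ext z
      simp only [Set.mem_sdiff, SimpleGraph.mem_neighborSet, Set.mem_insert_iff,
        Set.mem_singleton_iff, not_or]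
      by_cases zu : z = u
      · subst zu; simp [nxu]
      by_cases zv : z = p
      · subst zv; simp [G.adj_comm q, npq]
      by_cases zx : z = x
      · subst zx; simp
      by_cases zy : z = q
      · subst zy; simp
      have := hh z zu zv zx zy
      simp [this, zu, zv, zx, zy]
  -- decide sign
  obtain ⟨w, hw⟩ : ∃ w, ¬ (G.Adj u w ↔ G.Adj x w) := by
    by_contra hh; push Not at hh; exact e1 u x hux nux hh
  have hs : α 0 = α 2 ∨ α 0 = - α 2 := by
    have := h' w
    rw [h1] at this
    by_cases k1 : G.Adj u w <;> by_cases k2 : G.Adj x w <;> by_cases k3 : G.Adj v w <;>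
      by_cases k4 : G.Adj y w <;> simp [k1, k2, k3, k4] at this hw
    · exact absurd this h0
    · right; linarith
    · left; linarith
    · exact absurd this h0
    · exact absurd this h0
    · left; linarith
    · right; linarith
    · exact absurd this h0
  rcases hs with hs | hs
  · refine hquad y v (Or.inr ⟨rfl, rfl⟩) fun z z1 z2 z3 z4 => ?_
    have := h' z
    rw [h1, hs] at this
    refine sign_aux (α 2) h2 _ _ _ _ this (fun p q => ?_) (fun p q => ?_)
    · rcases no1 z p q with h | h | h | h
      exacts [Or.inl h, Or.inr h, absurd h z4, absurd h z2]
    · rcases no2 z p q with h | h | h | h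
      exacts [Or.inl h, Or.inr h, absurd h z1, absurd h z3]
  · refine hquad v y (Or.inl ⟨rfl, rfl⟩) fun z z1 z2 z3 z4 => ?_
    have := h' z
    rw [h1, hs] at this
    refine sign_aux (α 2) h2 _ _ _ _ (by linarith) (fun p q => ?_) (fun p q => ?_)
    · rcases no1 z p q with h | h | h | h
      exacts [Or.inr h, Or.inl h, absurd h z2, absurd h z4]
    · rcases no2 z q p with h | h | h | h
      exacts [Or.inl h, Or.inr h, absurd h z1, absurd h z3]

lemma form_single {ι : Type*} [Fintype ι] (G : SimpleGraph V) (φ : ι → V) (x : ι → ℝ) :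
    (Fintype.linearCombination ℝ (fun i => (Pi.single (φ i) (1:ℝ) : V → ℝ)) x) ⬝ᵥ
      (adjMat G *ᵥ (Fintype.linearCombination ℝ (fun i => (Pi.single (φ i) (1:ℝ) : V → ℝ)) x))
      = ∑ i, ∑ j, x i * x j * adjMat G (φ i) (φ j) := by
  simp only [Fintype.linearCombination_apply]
  rw [sum_dotProduct]
  refine Finset.sum_congr rfl fun i _ => ?_
  rw [Matrix.mulVec_sum, dotProduct_sum]
  refine Finset.sum_congr rfl fun j _ => ?_
  simp [Matrix.mulVec_smul]; ring

lemma no_C5 (G : SimpleGraph V) (hp : posCount G ≤ 2) (a b c d e : V)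
    (ab : G.Adj a b) (bc : G.Adj b c) (cd : G.Adj c d) (de : G.Adj d e) (ea : G.Adj e a)
    (ac : ¬ G.Adj a c) (bd : ¬ G.Adj b d) (ce : ¬ G.Adj c e) (da : ¬ G.Adj d a)
    (eb : ¬ G.Adj e b) : False := by
  classical
  let M : Matrix (Fin 5) (Fin 3) ℝ := !![1,2,0; 1,1,2; 1,-2,1; 1,-2,-1; 1,1,-2]
  have := finrank_le_posCount G ((Fintype.linearCombination ℝ
    (fun i => (Pi.single (![a,b,c,d,e] i) (1:ℝ) : V → ℝ))) ∘ₗ M.mulVecLin) (by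
    intro u hu
    rw [LinearMap.comp_apply, form_single]
    have hx : (M.mulVecLin u) = ![u 0 + 2 * u 1, u 0 + u 1 + 2 * u 2, u 0 - 2 * u 1 + u 2,
        u 0 - 2 * u 1 - u 2, u 0 + u 1 - 2 * u 2] := by
      ext i; fin_cases i <;> simp [M, Matrix.mulVec, dotProduct, Fin.sum_univ_three] <;> ring
    rw [hx]
    have hu' : 0 < u 0 ^ 2 + u 1 ^ 2 + u 2 ^ 2 := by
      by_contra hh
      have q0 : u 0 = 0 := by nlinarith [sq_nonneg (u 0), sq_nonneg (u 1), sq_nonneg (u 2)]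
      have q1 : u 1 = 0 := by nlinarith [sq_nonneg (u 0), sq_nonneg (u 1), sq_nonneg (u 2)]
      have q2 : u 2 = 0 := by nlinarith [sq_nonneg (u 0), sq_nonneg (u 1), sq_nonneg (u 2)]
      exact hu (by ext i; fin_cases i <;> assumption)
    have ca : ¬ G.Adj c a := fun h => ac h.symm
    have db : ¬ G.Adj d b := fun h => bd h.symm
    have ec : ¬ G.Adj e c := fun h => ce h.symm
    have ad : ¬ G.Adj a d := fun h => da h.symm
    have be : ¬ G.Adj b e := fun h => eb h.symm
    simp [Fin.sum_univ_five, adjMat_apply, ab, bc, cd, de, ea, ab.symm, bc.symm, cd.symm,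
      de.symm, ea.symm, ac, bd, ce, da, eb, ca, db, ec, ad, be]
    nlinarith [sq_nonneg (u 0), sq_nonneg (u 1), sq_nonneg (u 2)])
  simp at this
  omega
end structure2
end TwoPosEig

open Matrix BigOperators
namespace TwoPosEig
section structure3
variable {V : Type*} [Fintype V] [DecidableEq V]

lemma two_cliques (G : SimpleGraph V) (hne : ∀ v, ∃ w, G.Adj v w) (hp : posCount G ≤ 2)
    (hc : NoCong G) (hnc : ∃ u v, u ≠ v ∧ ¬ G.Adj u v) :
    ∃ B : V → Prop, (∀ u v, u ≠ v → (B u ↔ B v) → G.Adj u v) ∧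
      (∀ u u' w w', ¬ B u → ¬ B u' → B w → B w' → G.Adj u w → G.Adj u' w' →
        G.Adj u w' ∨ G.Adj u' w) ∧ (∃ a, ¬ B a ∧ ∀ w, B w → ¬ G.Adj a w) ∧ (∃ b, B b) := by
  classical
  let N : V → Finset V := fun v => Finset.univ.filter fun w => w ≠ v ∧ ¬ G.Adj v w
  have hN : ∀ v w, w ∈ N v ↔ w ≠ v ∧ ¬ G.Adj v w := by intro v w; simp [N]
  obtain ⟨u0, v0, h0, h0'⟩ := hnc
  obtain ⟨a, -, ha⟩ := Finset.exists_max_image Finset.univ (fun v => (N v).card)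
    ⟨u0, Finset.mem_univ _⟩
  have hBne : (N a).Nonempty := by
    rw [← Finset.card_pos]
    refine lt_of_lt_of_le ?_ (ha u0 (Finset.mem_univ _))
    exact Finset.card_pos.2 ⟨v0, (hN _ _).2 ⟨h0.symm, h0'⟩⟩
  have haN : a ∉ N a := by simp [hN]
  have i3 := no_indep3 G hne hp hc
  have c4 := no_C4 G hne hp hc
  have hcl : ∀ u v, u ≠ v → (u ∈ N a ↔ v ∈ N a) → G.Adj u v := by
    intro p q hpq hiff
    by_contra hn
    have hn' : ¬ G.Adj q p := fun h => hn h.symm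
    by_cases hpB : p ∈ N a
    · have hqB := hiff.1 hpB
      rw [hN] at hpB hqB
      exact i3 a p q hpB.1.symm hqB.1.symm hpq hpB.2 hqB.2 hn
    · have hqB : q ∉ N a := fun h => hpB (hiff.2 h)
      have hpa : p ≠ a := by
        rintro rfl
        exact hqB ((hN _ _).2 ⟨hpq.symm, hn⟩)
      have hqa : q ≠ a := by
        rintro rfl
        exact hpB ((hN _ _).2 ⟨hpq, hn'⟩)
      have aap : G.Adj a p := by
        by_contra h; exact hpB ((hN _ _).2 ⟨hpa, h⟩)
      have aaq : G.Adj a q := by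
        by_contra h; exact hqB ((hN _ _).2 ⟨hqa, h⟩)
      have hx : ∀ b ∈ N a, (¬ G.Adj p b ∧ G.Adj q b) ∨ (G.Adj p b ∧ ¬ G.Adj q b) := by
        intro b hb
        have hb' := (hN _ _).1 hb
        have bp : b ≠ p := by rintro rfl; exact hpB hb
        have bq : b ≠ q := by rintro rfl; exact hqB hb
        by_cases h1 : G.Adj p b
        · by_cases h2 : G.Adj q b
          · exact (c4 a p b q hb'.1.symm hpq aap h1 h2.symm aaq.symm hb'.2 hn).elim
          · exact Or.inr ⟨h1, h2⟩
        · by_cases h2 : G.Adj q b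
          · exact Or.inl ⟨h1, h2⟩
          · exact (i3 p q b hpq bp.symm bq.symm hn h1 h2).elim
      have mx : ∀ p q, p ≠ q → q ∉ N a → p ∉ N a → ¬ G.Adj p q → ¬ (∀ b ∈ N a, ¬ G.Adj p b) := by
        intro p q hpq hq hp' hn hall
        have hsub : insert q (N a) ⊆ N p := by
          intro z hz
          rw [Finset.mem_insert] at hz
          rcases hz with rfl | hz
          · exact (hN _ _).2 ⟨hpq.symm, hn⟩
          · exact (hN _ _).2 ⟨by rintro rfl; exact hp' hz, hall z hz⟩
        have h1 := Finset.card_le_card hsub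
        rw [Finset.card_insert_of_notMem hq] at h1
        have h2 := ha p (Finset.mem_univ _)
        omega
      have m1 := mx p q hpq hqB hpB hn
      have m2 := mx q p hpq.symm hpB hqB hn'
      push Not at m1 m2
      obtain ⟨b, hb, hb1⟩ := m1
      obtain ⟨b', hb', hb1'⟩ := m2
      have e1 : ¬ G.Adj q b := by
        rcases hx b hb with h | h
        · exact absurd hb1 h.1
        · exact h.2
      have e2 : ¬ G.Adj p b' := by
        rcases hx b' hb' with h | h
        · exact h.1
        · exact absurd hb1' h.2
      have nb := (hN _ _).1 hb
      have nb' := (hN _ _).1 hb'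
      have bb' : G.Adj b b' := by
        by_contra h
        refine i3 a b b' nb.1.symm nb'.1.symm ?_ nb.2 nb'.2 h
        rintro rfl; exact e2 hb1
      exact no_C5 G hp a p b b' q aap hb1 bb' hb1'.symm aaq.symm nb.2 e2 (fun h => e1 h.symm)
        (fun h => nb'.2 h.symm) hn'
  refine ⟨fun v => v ∈ N a, hcl, ?_, ⟨a, haN, fun w hw => ((hN _ _).1 hw).2⟩, hBne⟩
  intro u u' w w' hu hu' hw hw' h1 h2
  by_contra hh
  push Not at hh
  have e1 : u ≠ u' := by rintro rfl; exact hh.1 h2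
  have e2 : w ≠ w' := by rintro rfl; exact hh.1 h1
  refine c4 u w w' u' ?_ ?_ h1 (hcl _ _ e2 (by simp [hw, hw'])) h2.symm
    (hcl _ _ e1.symm (by simp [hu, hu'])) hh.1 (fun h => hh.2 h.symm)
  · rintro rfl; exact hu hw'
  · rintro rfl; exact hu' hw

lemma exists_levels (G : SimpleGraph V) (hcon : G.Connected) (B : V → Prop)
    (hcl : ∀ u v, u ≠ v → (B u ↔ B v) → G.Adj u v)
    (hnest : ∀ u u' w w', ¬ B u → ¬ B u' → B w → B w' → G.Adj u w → G.Adj u' w' →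
        G.Adj u w' ∨ G.Adj u' w)
    (ha : ∃ a, ¬ B a ∧ ∀ w, B w → ¬ G.Adj a w) (hb : ∃ b, B b) :
    ∃ (h : ℕ) (side : V → Bool) (lev : V → ℕ), 2 ≤ h ∧ (∀ v, lev v < h) ∧
      (∀ u v, G.Adj u v ↔ u ≠ v ∧ (side u = side v ∨ h ≤ lev u + lev v)) ∧
      (∀ i < h, ∃ v, side v = true ∧ lev v = i) ∧
      (∀ i < h, 1 ≤ i → ∃ v, side v = false ∧ lev v = i) := by
  classical
  obtain ⟨a, haB, haN⟩ := ha
  obtain ⟨b, hb⟩ := hb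
  let NB : V → Finset V := fun v => Finset.univ.filter fun w => B w ∧ G.Adj v w
  have hNB : ∀ v w, w ∈ NB v ↔ B w ∧ G.Adj v w := by intro v w; simp [NB]
  let r : V → ℕ := fun v => (NB v).card
  have hr : ∀ v v', ¬ B v → ¬ B v' → r v ≤ r v' → ∀ w, B w → G.Adj v w → G.Adj v' w := by
    intro v v' hv hv' hle w hw h1
    by_contra h2
    have hss : NB v' ⊂ NB v := by
      rw [Finset.ssubset_iff_of_subset]
      · exact ⟨w, (hNB _ _).2 ⟨hw, h1⟩, fun h => h2 ((hNB _ _).1 h).2⟩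
      · intro z hz
        have hz := (hNB _ _).1 hz
        rcases hnest v v' w z hv hv' hw hz.1 h1 hz.2 with h | h
        · exact (hNB _ _).2 ⟨hz.1, h⟩
        · exact absurd h h2
    have := Finset.card_lt_card hss
    simp only [r] at hle
    omega
  let R : Finset ℕ := (Finset.univ.filter fun v => ¬ B v).image r
  have hR : ∀ v, ¬ B v → r v ∈ R := fun v hv => Finset.mem_image_of_mem _ (by simpa using hv)
  let lA : V → ℕ := fun v => (R.filter fun x => x < r v).card
  let cset : V → Finset ℕ := fun w => R.filter fun x => ∃ v, ¬ B v ∧ r v = x ∧ G.Adj v w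
  have hadj : ∀ v w, ¬ B v → B w → (G.Adj v w ↔ R.card ≤ lA v + (cset w).card) := by
    intro v w hv hw
    have hsplit : lA v + (R.filter fun x => ¬ x < r v).card = R.card :=
      Finset.card_filter_add_card_filter_not _
    constructor
    · intro h
      have : (R.filter fun x => ¬ x < r v) ⊆ cset w := by
        intro x hx
        rw [Finset.mem_filter] at hx
        refine Finset.mem_filter.2 ⟨hx.1, ?_⟩
        obtain ⟨v', hv', rfl⟩ := Finset.mem_image.1 hx.1
        have hv'' : ¬ B v' := by simpa using hv'
        exact ⟨v', hv'', rfl, hr v v' hv hv'' (not_lt.1 hx.2) w hw h⟩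
      have := Finset.card_le_card this
      omega
    · intro h
      by_contra hn
      have : cset w ⊆ (R.filter fun x => ¬ x < r v).erase (r v) := by
        intro x hx
        obtain ⟨hx1, v', hv', rfl, hvw⟩ := Finset.mem_filter.1 hx
        have hlt : r v < r v' := by
          by_contra hge
          exact hn (hr v' v hv' hv (not_lt.1 hge) w hw hvw)
        exact Finset.mem_erase.2 ⟨hlt.ne', Finset.mem_filter.2 ⟨hx1, by omega⟩⟩
      have h1 := Finset.card_le_card this
      have hm : r v ∈ R.filter fun x => ¬ x < r v := Finset.mem_filter.2 ⟨hR v hv, by omega⟩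
      rw [Finset.card_erase_of_mem hm] at h1
      have := Finset.card_pos.2 ⟨_, hm⟩
      omega
  have hlA : ∀ v, ¬ B v → lA v < R.card := by
    intro v hv
    refine Finset.card_lt_card ?_
    rw [Finset.ssubset_iff_of_subset (Finset.filter_subset _ _)]
    exact ⟨r v, hR v hv, by simp⟩
  have hlB : ∀ w, B w → (cset w).card < R.card := by
    intro w hw
    have := mt (hadj a w haB hw).2 (haN w hw)
    omega
  have hsurj : ∀ i < R.card, ∃ v, ¬ B v ∧ lA v = i := by
    intro i hi
    have := Finset.surjOn_of_injOn_of_card_le (s := R) (t := Finset.range R.card)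
      (fun x => (R.filter fun y => y < x).card) (by
        intro x hx
        obtain ⟨v, hv, rfl⟩ := Finset.mem_image.1 hx
        simpa using hlA v (by simpa using hv)) (by
        intro x hx y hy hxy
        by_contra hne
        simp only at hxy
        have key : ∀ x y, x ∈ R → x < y → (R.filter fun z => z < x).card
            < (R.filter fun z => z < y).card := by
          intro x y hx hlt
          refine Finset.card_lt_card ?_
          rw [Finset.ssubset_iff_of_subset]
          · exact ⟨x, Finset.mem_filter.2 ⟨hx, hlt⟩, by simp⟩
          · intro z hz
            rw [Finset.mem_filter] at hz ⊢
            exact ⟨hz.1, hz.2.trans hlt⟩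
        rcases lt_or_gt_of_ne hne with h | h
        · have := key x y hx h; omega
        · have := key y x hy h; omega) (by simp)
    obtain ⟨x, hx, hxi⟩ := this (by simpa using hi : i ∈ (↑(Finset.range R.card) : Set ℕ))
    obtain ⟨v, hv, rfl⟩ := Finset.mem_image.1 hx
    exact ⟨v, by simpa using hv, hxi⟩
  have hedge : ∃ v w, ¬ B v ∧ B w ∧ G.Adj v w := by
    obtain ⟨p⟩ := hcon.preconnected a b
    obtain ⟨d, -, h1, h2⟩ := p.exists_boundary_dart {v | ¬ B v} haB (by simpa using hb)
    exact ⟨d.fst, d.snd, h1, by simpa using h2, d.adj⟩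
  have hside : ∀ v, decide (¬ B v) = true ↔ ¬ B v := by simp
  refine ⟨R.card, fun v => decide (¬ B v), fun v => if B v then (cset v).card else lA v,
    ?_, ?_, ?_, ?_, ?_⟩
  · obtain ⟨v, w, hv, hw, h⟩ := hedge
    have := (hadj v w hv hw).1 h
    have := hlA v hv
    have := hlB w hw
    omega
  · intro v
    by_cases hv : B v
    · simp [hv, hlB v hv]
    · simp [hv, hlA v hv]
  · intro u v
    by_cases huv : u = v
    · subst huv; simp
    by_cases hu : B u <;> by_cases hv : B v
    · simp [hu, hv, huv, hcl u v huv (by simp [hu, hv])]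
    · simp [hu, hv, huv]; rw [G.adj_comm, hadj v u hv hu, add_comm]
    · simp [hu, hv, huv]; rw [hadj u v hu hv]
    · simp [hu, hv, huv, hcl u v huv (by simp [hu, hv])]
  · intro i hi
    obtain ⟨v, hv, h⟩ := hsurj i hi
    exact ⟨v, by simp [hv], by simp [hv, h]⟩
  · intro i hi hi1
    obtain ⟨v, hv, h⟩ := hsurj (R.card - i) (by omega)
    obtain ⟨v', hv', h'⟩ := hsurj (R.card - i - 1) (by omega)
    have hn : ¬ ∀ w, B w → G.Adj v w → G.Adj v' w := by
      intro hall
      have : NB v ⊆ NB v' := by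
        intro z hz
        rw [hNB] at hz ⊢
        exact ⟨hz.1, hall z hz.1 hz.2⟩
      have h3 : r v ≤ r v' := Finset.card_le_card this
      have h4 : lA v ≤ lA v' := by
        refine Finset.card_le_card ?_
        intro z hz
        rw [Finset.mem_filter] at hz ⊢
        exact ⟨hz.1, by omega⟩
      omega
    push Not at hn
    obtain ⟨w, hw, h1, h2⟩ := hn
    rw [hadj v w hv hw] at h1
    rw [hadj v' w hv' hw] at h2
    exact ⟨w, by simp [hw], by simp only [hw, if_true]; omega⟩
end structure3
end TwoPosEig

open Matrix BigOperators
namespace TwoPosEig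
section isoB
variable {V : Type*} [Fintype V] [DecidableEq V]

lemma toIdx_inj (k : ℕ) : Function.Injective (toIdx (k := k)) := by
  rintro (i | i) (j | j) h <;> simp [toIdx, Fin.ext_iff] at h ⊢ <;> omega

lemma toIdx_surj (k : ℕ) : Function.Surjective (toIdx (k := k)) := by
  intro i
  by_cases hi : (i : ℕ) < (k + 1) / 2
  · exact ⟨Sum.inl ⟨i, hi⟩, rfl⟩
  · refine ⟨Sum.inr ⟨i - (k + 1) / 2, by omega⟩, ?_⟩
    simp [toIdx, Fin.ext_iff]; omega

lemma exists_iso (G : SimpleGraph V) (k : ℕ) (φ : V → Fin ((k + 1) / 2) ⊕ Fin (k / 2))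
    (hφ : Function.Surjective φ)
    (h : ∀ u v, G.Adj u v ↔ u ≠ v ∧ (φ u = φ v ∨ (oboudi k).Adj (φ u) (φ v))) :
    ∃ nn : Fin k → ℕ, (∀ i, 1 ≤ nn i) ∧ ∑ i, nn i = Fintype.card V ∧
      Nonempty (G ≃g bGraph k nn) := by
  classical
  refine ⟨fun i => Fintype.card {v // toIdx (φ v) = i}, ?_, ?_, ?_⟩
  · intro i
    obtain ⟨c, rfl⟩ := toIdx_surj k i
    obtain ⟨v, rfl⟩ := hφ c
    exact Fintype.card_pos_iff.2 ⟨⟨v, rfl⟩⟩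
  · rw [← Fintype.card_sigma]
    exact Fintype.card_congr (Equiv.sigmaFiberEquiv fun v => toIdx (φ v))
  · let e1 : V ≃ Σ c, {v // φ v = c} := (Equiv.sigmaFiberEquiv φ).symm
    let e2 : (Σ c, {v // φ v = c}) ≃
        Σ c : Fin ((k + 1) / 2) ⊕ Fin (k / 2), Fin (Fintype.card {v // toIdx (φ v) = toIdx c}) :=
      Equiv.sigmaCongrRight fun c => Fintype.equivFinOfCardEq
        (Fintype.card_congr (Equiv.subtypeEquivRight fun v => (toIdx_inj k).eq_iff.symm))
    refine ⟨⟨e1.trans e2, ?_⟩⟩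
    intro u v
    have hne : (e1.trans e2) u ≠ (e1.trans e2) v ↔ u ≠ v := (e1.trans e2).injective.ne_iff
    have h1 : ∀ u, ((e1.trans e2) u).1 = φ u := fun u => rfl
    unfold bGraph lexProd
    rw [SimpleGraph.fromRel_adj, hne, h1, h1, h, (oboudi k).adj_comm (φ v), eq_comm (a := φ v),
      or_self]

lemma oboudi_lr (k : ℕ) (i : Fin ((k + 1) / 2)) (j : Fin (k / 2)) :
    (oboudi k).Adj (Sum.inl i) (Sum.inr j) ↔ k / 2 ≤ (i : ℕ) + j := by
  simp [oboudi]
lemma oboudi_ll (k : ℕ) (i j : Fin ((k + 1) / 2)) :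
    (oboudi k).Adj (Sum.inl i) (Sum.inl j) ↔ i ≠ j := by
  simp [oboudi]
lemma oboudi_rr (k : ℕ) (i j : Fin (k / 2)) :
    (oboudi k).Adj (Sum.inr i) (Sum.inr j) ↔ i ≠ j := by
  simp [oboudi]

lemma iso_of_shift (G : SimpleGraph V) (h : ℕ) (side : V → Bool) (lev : V → ℕ)
    (hlev : ∀ v, lev v < h)
    (hadj : ∀ u v, G.Adj u v ↔ u ≠ v ∧ (side u = side v ∨ h ≤ lev u + lev v))
    (hA : ∀ i < h, ∃ v, side v = true ∧ lev v = i)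
    (d : ℕ) (hd : d ≤ h) (hB : ∀ i < h, d ≤ i → ∃ v, side v = false ∧ lev v = i)
    (hB' : ∀ v, side v = false → d ≤ lev v) (k : ℕ) (hk1 : (k + 1) / 2 = h) (hk2 : k / 2 + d = h) :
    ∃ nn : Fin k → ℕ, (∀ i, 1 ≤ nn i) ∧ ∑ i, nn i = Fintype.card V ∧
      Nonempty (G ≃g bGraph k nn) := by
  classical
  let φ : V → Fin ((k + 1) / 2) ⊕ Fin (k / 2) := fun v =>
    if hs : side v = true then Sum.inl ⟨lev v, by rw [hk1]; exact hlev v⟩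
    else Sum.inr ⟨lev v - d, by
      have := hB' v (by simpa using hs)
      have := hlev v
      omega⟩
  have f1 : ∀ v, side v = true → φ v = Sum.inl ⟨lev v, by rw [hk1]; exact hlev v⟩ := by
    intro v hs; simp [φ, hs]
  have f2 : ∀ v (hs : side v = false), φ v = Sum.inr ⟨lev v - d, by
      have := hB' v hs
      have := hlev v
      omega⟩ := by
    intro v hs; simp [φ, hs]
  refine exists_iso G k φ ?_ ?_
  · rintro (⟨i, hi⟩ | ⟨j, hj⟩)
    · obtain ⟨v, hv, rfl⟩ := hA i (by omega)
      exact ⟨v, f1 v hv⟩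
    · obtain ⟨v, hv, hl⟩ := hB (j + d) (by omega) (by omega)
      exact ⟨v, by rw [f2 v hv]; simp [hl]⟩
  · intro u v
    rw [hadj]
    refine and_congr_right fun _ => ?_
    cases hu : side u <;> cases hv : side v
    · rw [f2 u hu, f2 v hv, oboudi_rr]
      simp [em]
    · rw [f2 u hu, f1 v hv, SimpleGraph.adj_comm, oboudi_lr]
      have := hB' u hu
      simp; omega
    · rw [f1 u hu, f2 v hv, oboudi_lr]
      have := hB' v hv
      simp; omega
    · rw [f1 u hu, f1 v hv, oboudi_ll]
      simp [em]

lemma levels_iso (G : SimpleGraph V) (h : ℕ) (side : V → Bool) (lev : V → ℕ) (h2 : 2 ≤ h)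
    (hlev : ∀ v, lev v < h)
    (hadj : ∀ u v, G.Adj u v ↔ u ≠ v ∧ (side u = side v ∨ h ≤ lev u + lev v))
    (hA : ∀ i < h, ∃ v, side v = true ∧ lev v = i)
    (hB : ∀ i < h, 1 ≤ i → ∃ v, side v = false ∧ lev v = i)
    (h3 : h = 2 → ∃ v, side v = false ∧ lev v = 0) :
    ∃ k, 4 ≤ k ∧ k ≤ Fintype.card V ∧
    ∃ nn : Fin k → ℕ, (∀ i, 1 ≤ nn i) ∧ ∑ i, nn i = Fintype.card V ∧
      Nonempty (G ≃g bGraph k nn) := by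
  have key : ∃ k, 4 ≤ k ∧ 
    ∃ nn : Fin k → ℕ, (∀ i, 1 ≤ nn i) ∧ ∑ i, nn i = Fintype.card V ∧
      Nonempty (G ≃g bGraph k nn) := by
    by_cases h0 : ∃ v, side v = false ∧ lev v = 0
    · refine ⟨2 * h, by omega, iso_of_shift G h side lev hlev hadj hA 0 (by omega) ?_
        (by simp) _ (by omega) (by omega)⟩
      intro i hi _
      rcases Nat.eq_zero_or_pos i with rfl | hp
      · exact h0
      · exact hB i hi hp
    · refine ⟨2 * h - 1, ?_, iso_of_shift G h side lev hlev hadj hA 1 (by omega) hB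
        ?_ _ (by omega) (by omega)⟩
      · have : h ≠ 2 := fun hh => h0 (h3 hh)
        omega
      · intro v hv
        by_contra hl
        exact h0 ⟨v, hv, by omega⟩
  obtain ⟨k, hk, nn, h1, hs, e⟩ := key
  refine ⟨k, hk, ?_, nn, h1, hs, e⟩
  rw [← hs]
  calc k = ∑ i : Fin k, 1 := by simp
    _ ≤ _ := Finset.sum_le_sum fun i _ => h1 i
end isoB
end TwoPosEig

open Matrix BigOperators
namespace TwoPosEig
section chain

/-- transfer map -/
def tr : List ℤ → ℝ × ℝ → ℝ × ℝ
  | [], s => s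
  | c :: l, s => tr l (s.2, (c : ℝ) * s.2 - s.1)

lemma tr_append (l l' : List ℤ) (s : ℝ × ℝ) : tr (l ++ l') s = tr l' (tr l s) := by
  induction l generalizing s with
  | nil => rfl
  | cons c l ih => simp [tr, ih]

lemma tr_neg (l : List ℤ) (s : ℝ × ℝ) : tr l (-s) = - tr l s := by
  induction l generalizing s with
  | nil => rfl
  | cons c l ih =>
    simp only [tr]
    rw [← ih]
    congr 1
    ext <;> simp; ring

/-- chain energy with previous value `p` -/
def en : ℝ → List (ℤ × ℝ) → ℝ
  | _, [] => 0
  | p, cx :: l => (cx.1 : ℝ) * cx.2 ^ 2 - 2 * p * cx.2 + en cx.2 l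

def lastv : ℝ → List (ℤ × ℝ) → ℝ
  | p, [] => p
  | _, cx :: l => lastv cx.2 l

def headv : List (ℤ × ℝ) → ℝ
  | [] => 0
  | cx :: _ => cx.2

lemma en_append (p : ℝ) (l l' : List (ℤ × ℝ)) : en p (l ++ l') = en p l + en (lastv p l) l' := by
  induction l generalizing p with
  | nil => simp [en, lastv]
  | cons c l ih => simp [en, lastv, ih]; ring

lemma lastv_append (p : ℝ) (l l' : List (ℤ × ℝ)) : lastv p (l ++ l') = lastv (lastv p l) l' := by
  induction l generalizing p with
  | nil => simp [lastv]
  | cons c l ih => simp [lastv, ih]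

/-- evaluation -/
def ev {d : ℕ} (u : Fin d → ℝ) (L : List (ℤ × ((Fin d → ℝ) →ₗ[ℝ] ℝ))) : List (ℤ × ℝ) :=
  L.map fun q => (q.1, q.2 u)

/-- negation of functionals -/
def ng {d : ℕ} (L : List (ℤ × ((Fin d → ℝ) →ₗ[ℝ] ℝ))) : List (ℤ × ((Fin d → ℝ) →ₗ[ℝ] ℝ)) :=
  L.map fun q => (q.1, -q.2)

/-- projection forgetting coordinate zero -/
def pj (d : ℕ) : (Fin (d + 1) → ℝ) →ₗ[ℝ] (Fin d → ℝ) := LinearMap.funLeft ℝ ℝ Fin.succ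

def lf {d : ℕ} (L : List (ℤ × ((Fin d → ℝ) →ₗ[ℝ] ℝ))) :
    List (ℤ × ((Fin (d + 1) → ℝ) →ₗ[ℝ] ℝ)) :=
  L.map fun q => (q.1, q.2 ∘ₗ pj d)

lemma ev_lf {d : ℕ} (u : Fin (d + 1) → ℝ) (L : List (ℤ × ((Fin d → ℝ) →ₗ[ℝ] ℝ))) :
    ev u (lf L) = ev (pj d u) L := by
  simp [ev, lf, Function.comp_def]

lemma en_ng {d : ℕ} (u : Fin d → ℝ) (L : List (ℤ × ((Fin d → ℝ) →ₗ[ℝ] ℝ))) (p : ℝ) :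
    en (-p) (ev u (ng L)) = en p (ev u L) := by
  induction L generalizing p with
  | nil => simp [ev, ng, en]
  | cons c l ih =>
    simp only [ev, ng, List.map_cons, en] at ih ⊢
    rw [LinearMap.neg_apply, ih]; ring

lemma lastv_ng {d : ℕ} (u : Fin d → ℝ) (L : List (ℤ × ((Fin d → ℝ) →ₗ[ℝ] ℝ))) (p : ℝ) :
    lastv (-p) (ev u (ng L)) = - lastv p (ev u L) := by
  induction L generalizing p with
  | nil => simp [ev, ng, lastv]
  | cons c l ih =>
    simp only [ev, ng, List.map_cons, lastv] at ih ⊢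
    rw [LinearMap.neg_apply, ih]

lemma fst_lf {d : ℕ} (L : List (ℤ × ((Fin d → ℝ) →ₗ[ℝ] ℝ))) :
    (lf L).map Prod.fst = L.map Prod.fst := by simp [lf, Function.comp_def]
lemma fst_ng {d : ℕ} (L : List (ℤ × ((Fin d → ℝ) →ₗ[ℝ] ℝ))) :
    (ng L).map Prod.fst = L.map Prod.fst := by simp [ng, Function.comp_def]
lemma ev_append {d : ℕ} (u : Fin d → ℝ) (L M : List (ℤ × ((Fin d → ℝ) →ₗ[ℝ] ℝ))) :
    ev u (L ++ M) = ev u L ++ ev u M := by simp [ev]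
lemma ev_cons {d : ℕ} (u : Fin d → ℝ) (q) (L : List (ℤ × ((Fin d → ℝ) →ₗ[ℝ] ℝ))) :
    ev u (q :: L) = (q.1, q.2 u) :: ev u L := by simp [ev]
lemma ev_nil {d : ℕ} (u : Fin d → ℝ) : ev u [] = [] := rfl

lemma headv_append (x : ℤ × ℝ) (l l' m : List (ℤ × ℝ)) :
    headv (l ++ x :: m) = headv (l ++ x :: l') := by
  cases l <;> rfl

/-- the output of the quadratic form lemma -/
def Good (C : List ℤ) (ε : ℝ) (d : ℕ) : Prop :=
  ∃ L : List (ℤ × ((Fin d → ℝ) →ₗ[ℝ] ℝ)), L.map Prod.fst = C ∧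
    (∀ u, lastv 0 (ev u L) = ε * headv (ev u L)) ∧
    (∀ u, 0 ≤ en 0 (ev u L)) ∧ (∀ u, en 0 (ev u L) = 0 → u = 0)

lemma pj_eq_zero {d : ℕ} (u : Fin (d + 1) → ℝ) (h : pj d u = 0) (h0 : u 0 = 0) : u = 0 := by
  ext i
  refine Fin.cases h0 (fun j => ?_) i
  exact congrFun h j

lemma extend {d : ℕ} (E : (Fin d → ℝ) → ℝ) (E' : (Fin (d + 1) → ℝ) → ℝ)
    (h : ∀ u, E' u = E (pj d u) + (u 0) ^ 2) (h1 : ∀ u, 0 ≤ E u) (h2 : ∀ u, E u = 0 → u = 0) :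
    (∀ u, 0 ≤ E' u) ∧ (∀ u, E' u = 0 → u = 0) := by
  refine ⟨fun u => ?_, fun u hu => ?_⟩
  · rw [h]; have := h1 (pj d u); positivity
  · rw [h] at hu
    have := h1 (pj d u)
    have h3 := sq_nonneg (u 0)
    exact pj_eq_zero u (h2 _ (by linarith)) (by
      have : (u 0) ^ 2 = 0 := by linarith
      simpa using this)

lemma good_one (K1 K2 : List ℤ) (a b : ℤ) (ε : ℝ) (d : ℕ)
    (h : Good (K1 ++ (a - 1) :: (b - 1) :: K2) ε d) :
    Good (K1 ++ a :: 1 :: b :: K2) ε (d + 1) := by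
  obtain ⟨L, hL, hl, h1, h2⟩ := h
  obtain ⟨L1, L2, rfl, e1, e2⟩ := List.map_eq_append_iff.1 hL
  obtain ⟨⟨c, X⟩, L3, rfl, e3, e4⟩ := List.map_eq_cons_iff.1 e2
  obtain ⟨⟨c', Z⟩, L4, rfl, e5, e6⟩ := List.map_eq_cons_iff.1 e4
  simp only at e3 e5
  subst e3 e5
  have := extend (fun u => en 0 (ev u (L1 ++ (a - 1, X) :: (b - 1, Z) :: L4)))
    (fun u => en 0 (ev u (lf L1 ++ (a, X ∘ₗ pj d) ::
      (1, (X + Z) ∘ₗ pj d + LinearMap.proj 0) :: (b, Z ∘ₗ pj d) :: lf L4))) (by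
      intro u
      simp only [ev_append, ev_cons, ev_lf, en_append, en, LinearMap.comp_apply,
        LinearMap.add_apply, LinearMap.proj_apply]
      push_cast
      ring) h1 h2
  refine ⟨_, ?_, ?_, this.1, this.2⟩
  · simp [fst_lf, e1, e6]
  · intro u
    have := hl (pj d u)
    simp only [ev_append, ev_cons, ev_lf, lastv_append, lastv, LinearMap.comp_apply] at this ⊢
    rw [this]
    cases ev ((pj d) u) L1 <;> simp [headv]

lemma good_neg (K1 K2 : List ℤ) (a b : ℤ) (ε : ℝ) (d : ℕ)
    (h : Good (K1 ++ (a + 1) :: (b + 1) :: K2) (-ε) d) :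
    Good (K1 ++ a :: (-1) :: b :: K2) ε d := by
  obtain ⟨L, hL, hl, h1, h2⟩ := h
  obtain ⟨L1, L2, rfl, e1, e2⟩ := List.map_eq_append_iff.1 hL
  obtain ⟨⟨c, X⟩, L3, rfl, e3, e4⟩ := List.map_eq_cons_iff.1 e2
  obtain ⟨⟨c', Y⟩, L4, rfl, e5, e6⟩ := List.map_eq_cons_iff.1 e4
  simp only at e3 e5
  subst e3 e5
  have key : ∀ u, en 0 (ev u (L1 ++ (a, X) :: (-1, Y - X) :: (b, -Y) :: ng L4))
      = en 0 (ev u (L1 ++ (a + 1, X) :: (b + 1, Y) :: L4)) := by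
    intro u
    simp only [ev_append, ev_cons, en_append, en, LinearMap.neg_apply, en_ng,
        LinearMap.sub_apply]
    push_cast
    ring
  refine ⟨L1 ++ (a, X) :: (-1, Y - X) :: (b, -Y) :: ng L4, ?_, ?_, ?_, ?_⟩
  · simp [fst_ng, e1, e6]
  · intro u
    have := hl u
    simp only [ev_append, ev_cons, lastv_append, lastv, LinearMap.neg_apply, lastv_ng] at this ⊢
    rw [this]
    cases ev u L1 <;> simp [headv]
  · intro u; rw [key]; exact h1 u
  · intro u hu; rw [key] at hu; exact h2 u hu

lemma good_zero_right (K1 K2 : List ℤ) (a b k : ℤ) (ε : ℝ) (d : ℕ)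
    (h : Good (K1 ++ (a + b) :: k :: K2) (-ε) d) :
    Good (K1 ++ a :: 0 :: b :: k :: K2) ε (d + 1) := by
  obtain ⟨L, hL, hl, h1, h2⟩ := h
  obtain ⟨L1, L2, rfl, e1, e2⟩ := List.map_eq_append_iff.1 hL
  obtain ⟨⟨c, X⟩, L3, rfl, e3, e4⟩ := List.map_eq_cons_iff.1 e2
  obtain ⟨⟨c', K⟩, L4, rfl, e5, e6⟩ := List.map_eq_cons_iff.1 e4
  simp only at e3 e5
  subst e3 e5
  have := extend (fun u => en 0 (ev u (L1 ++ (a + b, X) :: (c', K) :: L4)))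
    (fun u => en 0 (ev u (lf L1 ++ (a, X ∘ₗ pj d) ::
      (0, ((-(b : ℝ)) • X + K) ∘ₗ pj d + ((b : ℝ) / 2 - 1 / 2) • LinearMap.proj 0) ::
      (b, LinearMap.proj 0 - X ∘ₗ pj d) :: (c', - (K ∘ₗ pj d)) :: ng (lf L4)))) (by
      intro u
      simp only [ev_append, ev_cons, ev_lf, en_append, en, LinearMap.comp_apply, en_ng,
        LinearMap.add_apply, LinearMap.proj_apply, LinearMap.neg_apply, LinearMap.sub_apply,
        LinearMap.smul_apply, smul_eq_mul]
      push_cast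
      ring) h1 h2
  refine ⟨_, ?_, ?_, this.1, this.2⟩
  · simp [fst_lf, fst_ng, e1, e6]
  · intro u
    have := hl (pj d u)
    simp only [ev_append, ev_cons, ev_lf, lastv_append, lastv, LinearMap.comp_apply,
      LinearMap.neg_apply, lastv_ng] at this ⊢
    rw [this]
    cases ev ((pj d) u) L1 <;> simp [headv]

lemma good_zero_left (K0 : List ℤ) (a b k : ℤ) (ε : ℝ) (d : ℕ)
    (h : Good (K0 ++ k :: [a + b]) (-ε) d) :
    Good (K0 ++ k :: a :: 0 :: [b]) ε (d + 1) := by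
  obtain ⟨L, hL, hl, h1, h2⟩ := h
  obtain ⟨L1, L2, rfl, e1, e2⟩ := List.map_eq_append_iff.1 hL
  obtain ⟨⟨c, K⟩, L3, rfl, e3, e4⟩ := List.map_eq_cons_iff.1 e2
  obtain ⟨⟨c', Z⟩, L4, rfl, e5, e6⟩ := List.map_eq_cons_iff.1 e4
  simp only [List.map_eq_nil_iff] at e3 e5 e6
  subst e3 e5 e6
  have := extend (fun u => en 0 (ev u (L1 ++ (c, K) :: [(a + b, Z)])))
    (fun u => en 0 (ev u (lf L1 ++ (c, K ∘ₗ pj d) :: (a, Z ∘ₗ pj d + LinearMap.proj 0) ::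
      (0, ((a : ℝ) • Z - K) ∘ₗ pj d + ((a : ℝ) / 2 - 1 / 2) • LinearMap.proj 0) ::
      [(b, - (Z ∘ₗ pj d))]))) (by
      intro u
      simp only [ev_append, ev_cons, ev_nil, ev_lf, en_append, en, LinearMap.comp_apply, en_ng,
        LinearMap.add_apply, LinearMap.proj_apply, LinearMap.neg_apply, LinearMap.sub_apply,
        LinearMap.smul_apply, smul_eq_mul]
      push_cast
      ring) h1 h2
  refine ⟨_, ?_, ?_, this.1, this.2⟩
  · simp [fst_lf, e1]
  · intro u
    have := hl (pj d u)
    simp only [ev_append, ev_cons, ev_nil, ev_lf, lastv_append, lastv, LinearMap.comp_apply,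
      LinearMap.neg_apply] at this ⊢
    rw [this]
    cases ev ((pj d) u) L1 <;> simp [headv]

lemma tr_grow (I : List ℤ) (hI : ∀ c ∈ I, 2 ≤ |c|) (s : ℝ × ℝ) (hs : |s.1| < |s.2|) :
    |(tr I s).1| < |(tr I s).2| := by
  induction I generalizing s with
  | nil => exact hs
  | cons c l ih =>
    refine ih (fun c hc => hI c (List.mem_cons_of_mem _ hc)) _ ?_
    have h1 : (2 : ℝ) ≤ |(c : ℝ)| := by
      have := hI c List.mem_cons_self
      exact_mod_cast this
    have h2 : |(c : ℝ) * s.2| - |s.1| ≤ |(c : ℝ) * s.2 - s.1| := abs_sub_abs_le_abs_sub _ _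
    rw [abs_mul] at h2
    have := abs_nonneg s.2
    simp only
    nlinarith

lemma exists_small (C : List ℤ) (hm : 2 ≤ C.length) (ε : ℝ)
    (h : ∀ p x, tr C (p, x) = (ε * x, -ε * p)) :
    ∃ K1 a c b K2, C = K1 ++ a :: c :: b :: K2 ∧ |c| ≤ 1 := by
  obtain ⟨e1, C1, rfl⟩ := List.exists_cons_of_length_pos (l := C) (by omega)
  have hC1 : C1 ≠ [] := by rintro rfl; simp at hm
  obtain ⟨I, e2, rfl⟩ : ∃ I e2, C1 = I ++ [e2] :=
    ⟨C1.dropLast, C1.getLast hC1, (List.dropLast_append_getLast hC1).symm⟩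
  have hI : ∃ c ∈ I, |c| ≤ 1 := by
    by_contra hcon
    push Not at hcon
    have h1 := h (-1) 0
    have h2 := tr_grow I (fun c hc => hcon c hc) (0, 1) (by simp)
    simp only [tr, tr_append] at h1
    have h3 := congrArg Prod.fst h1
    simp at h3
    rw [h3] at h2
    simp at h2
    exact absurd h2 (not_lt.2 (abs_nonneg _))
  obtain ⟨c, hc, hc1⟩ := hI
  obtain ⟨I1, I2, rfl⟩ := List.append_of_mem hc
  obtain ⟨K1, a, hK1⟩ : ∃ K1 a, e1 :: I1 = K1 ++ [a] :=
    ⟨(e1 :: I1).dropLast, (e1 :: I1).getLast (by simp),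
      (List.dropLast_append_getLast (by simp)).symm⟩
  obtain ⟨b, K2, hK2⟩ : ∃ b K2, I2 ++ [e2] = b :: K2 :=
    List.exists_cons_of_ne_nil (by simp)
  refine ⟨K1, a, c, b, K2, ?_, hc1⟩
  have : e1 :: (I1 ++ c :: I2 ++ [e2]) = (e1 :: I1) ++ c :: (I2 ++ [e2]) := by simp
  rw [this, hK1, hK2]; simp

lemma Q_lemma (m : ℕ) : ∀ (C : List ℤ) (ε : ℝ), C.length = m → 2 ≤ m →
    (∀ p x, tr C (p, x) = (ε * x, -ε * p)) →
    ∃ d : ℕ, (6 * d : ℤ) = 3 * (m - 1) - 6 + C.sum ∧ Good C ε d := by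
  induction m using Nat.strong_induction_on with
  | _ m ih =>
  intro C ε hm hm2 h
  obtain ⟨K1, a, c, b, K2, rfl, hc⟩ := exists_small C (by omega) ε h
  have hlen : m = K1.length + K2.length + 3 := by simp at hm; omega
  have hc' : c = 1 ∨ c = -1 ∨ c = 0 := by
    rw [abs_le] at hc; omega
  rcases hc' with rfl | rfl | rfl
  · obtain ⟨d, hd, hg⟩ := ih (m - 1) (by omega) (K1 ++ (a - 1) :: (b - 1) :: K2) ε
      (by simp; omega) (by omega) (by
        intro p x
        rw [← h p x]
        simp only [tr_append, tr]
        congr 1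
        ext <;> push_cast <;> ring)
    refine ⟨d + 1, ?_, good_one _ _ _ _ _ _ hg⟩
    rw [Nat.cast_sub (by omega)] at hd
    simp at hd ⊢
    linarith
  · obtain ⟨d, hd, hg⟩ := ih (m - 1) (by omega) (K1 ++ (a + 1) :: (b + 1) :: K2) (-ε)
      (by simp; omega) (by omega) (by
        intro p x
        have e := h p x
        simp only [tr_append, tr] at e ⊢
        rw [show ((-ε * x, - -ε * p) : ℝ × ℝ) = -(ε * x, -ε * p) by ext <;> simp, ← e,
          ← tr_neg]
        congr 1
        ext <;> push_cast <;> simp <;> ring)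
    refine ⟨d, ?_, good_neg _ _ _ _ _ _ hg⟩
    rw [Nat.cast_sub (by omega)] at hd
    simp at hd ⊢
    linarith
  · have htr : ∀ p x, tr (K1 ++ (a + b) :: K2) (p, x) = (-ε * x, - -ε * p) := by
      intro p x
      have e := h p x
      simp only [tr_append, tr] at e ⊢
      rw [show ((-ε * x, - -ε * p) : ℝ × ℝ) = -(ε * x, -ε * p) by ext <;> simp, ← e,
        ← tr_neg]
      congr 1
      ext <;> push_cast <;> simp <;> ring
    rcases K2 with _ | ⟨k, K3⟩
    · rcases List.eq_nil_or_concat K1 with rfl | ⟨K0, k, rfl⟩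
      · -- base
        simp only [List.nil_append, tr] at htr
        have t1 := htr 0 1
        have t2 := htr 1 0
        simp at t1 t2
        have hab : a + b = 0 := by
          have := t1.2
          exact_mod_cast this
        refine ⟨0, by simp at hlen; subst hlen; simp; linarith, ?_⟩
        refine ⟨[(a, 0), (0, 0), (b, 0)], by simp, ?_, ?_, ?_⟩
        · intro u; simp [ev, lastv, headv]
        · intro u; simp [ev, en]
        · intro u _; exact Subsingleton.elim _ _
      · simp at hlen
        simp only [List.concat_eq_append, List.append_assoc, List.singleton_append] at *
        obtain ⟨d, hd, hg⟩ := ih (m - 2) (by omega) _ (-ε)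
          (by simp; omega) (by omega) htr
        refine ⟨d + 1, ?_, good_zero_left _ _ _ _ _ _ hg⟩
        rw [Nat.cast_sub (by omega)] at hd
        simp at hd ⊢
        linarith
    · simp at hlen
      obtain ⟨d, hd, hg⟩ := ih (m - 2) (by omega) _ (-ε)
          (by simp; omega) (by omega) htr
      refine ⟨d + 1, ?_, good_zero_right _ _ _ _ _ _ _ hg⟩
      rw [Nat.cast_sub (by omega)] at hd
      simp at hd ⊢
      linarith
end chain
end TwoPosEig

open Matrix BigOperators
namespace TwoPosEig
section kernel
variable {V : Type*} [Fintype V] [DecidableEq V]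

/-- weighted sums -/
def Ws (h : ℕ) (side : V → Bool) (lev : V → ℕ) (x : V → ℝ) (s : Bool) (i : ℕ) : ℝ :=
  ∑ v, if side v = s ∨ h ≤ i + lev v then x v else 0

/-- class sizes -/
def cnt (side : V → Bool) (lev : V → ℕ) (s : Bool) (i : ℕ) : ℕ :=
  (Finset.univ.filter fun v => side v = s ∧ lev v = i).card

variable (G : SimpleGraph V) (h : ℕ) (side : V → Bool) (lev : V → ℕ)

lemma Ws_adj (hadj : ∀ u v, G.Adj u v ↔ u ≠ v ∧ (side u = side v ∨ h ≤ lev u + lev v))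
    (x : V → ℝ) (v : V) : (adjMat G *ᵥ x) v = Ws h side lev x (side v) (lev v) - x v := by
  classical
  rw [adjMat_mulVec, Ws, ← Finset.add_sum_erase _ _ (Finset.mem_univ v),
    ← Finset.add_sum_erase Finset.univ (fun w => if side w = side v ∨ h ≤ lev v + lev w
      then x w else 0) (Finset.mem_univ v)]
  simp only [SimpleGraph.irrefl, if_false, true_or, if_true, zero_add, add_sub_cancel_left]
  refine Finset.sum_congr rfl fun w hw => ?_
  have : v ≠ w := (Finset.ne_of_mem_erase hw).symm
  simp [hadj, this, eq_comm]

lemma Ws_zero (hlev : ∀ v, lev v < h) (x : V → ℝ) (s : Bool) :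
    Ws h side lev x s 0 = ∑ v, if side v = s then x v else 0 := by
  refine Finset.sum_congr rfl fun v _ => ?_
  have : ¬ h ≤ lev v := by have := hlev v; omega
  simp [this]

lemma Ws_top (x : V → ℝ) (s : Bool) : Ws h side lev x s h = ∑ v, x v := by
  simp [Ws]

lemma Ws_sum (hlev : ∀ v, lev v < h) (x : V → ℝ) (s : Bool) :
    Ws h side lev x s h = Ws h side lev x true 0 + Ws h side lev x false 0 := by
  rw [Ws_top, Ws_zero _ _ _ hlev, Ws_zero _ _ _ hlev, ← Finset.sum_add_distrib]
  refine Finset.sum_congr rfl fun v _ => ?_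
  cases side v <;> simp

lemma sum_cnt (g : Bool → ℕ → ℝ) (s : Bool) (j : ℕ) :
    (∑ v, if side v = s ∧ lev v = j then g (side v) (lev v) else 0) = cnt side lev s j * g s j := by
  rw [← Finset.sum_filter, cnt, ← nsmul_eq_mul]
  rw [← Finset.sum_const]
  refine Finset.sum_congr rfl fun v hv => ?_
  obtain ⟨h1, h2⟩ := (Finset.mem_filter.1 hv).2
  rw [h1, h2]

lemma Ws_step (g : Bool → ℕ → ℝ) (x : V → ℝ) (hx : ∀ v, x v = g (side v) (lev v))
    (s : Bool) (i j : ℕ) (hij : i + j + 1 = h) :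
    Ws h side lev x s (i + 1) = Ws h side lev x s i + cnt side lev (!s) j * g (!s) j := by
  rw [← sum_cnt side lev g, Ws, Ws, ← Finset.sum_add_distrib]
  refine Finset.sum_congr rfl fun v _ => ?_
  rw [hx v]
  by_cases h1 : side v = s
  · simp [h1]
  · have h2 : side v = !s := by cases s <;> simpa using h1
    have h3 : ¬ (!s) = s := by cases s <;> simp
    simp only [h2, h3, false_or, true_and]
    rcases lt_trichotomy (lev v) j with hl | hl | hl
    · rw [if_neg (by omega), if_neg (by omega), if_neg (by omega)]; simp
    · rw [if_pos (by omega), if_neg (by omega), if_pos hl]; simp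
    · rw [if_pos (by omega), if_pos (by omega), if_neg (by omega)]; simp

lemma sum_side (hlev : ∀ v, lev v < h) (g : Bool → ℕ → ℝ) (s : Bool) :
    (∑ v, if side v = s then g (side v) (lev v) else 0)
      = ∑ j ∈ Finset.range h, cnt side lev s j * g s j := by
  simp_rw [← sum_cnt side lev g]
  rw [Finset.sum_comm]
  refine Finset.sum_congr rfl fun v _ => ?_
  by_cases hs : side v = s
  · simp [hs, hlev v]
  · simp [hs]

lemma card_eq_cnt (hlev : ∀ v, lev v < h) : (Fintype.card V : ℤ) =
    ∑ j ∈ Finset.range h, ((cnt side lev true j : ℤ) + cnt side lev false j) := by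
  have h1 := sum_side h side lev hlev (fun _ _ => 1) true
  have h2 := sum_side h side lev hlev (fun _ _ => 1) false
  have h3 : (Fintype.card V : ℝ) = (∑ v : V, if side v = true then (1 : ℝ) else 0) +
      (∑ v : V, if side v = false then (1 : ℝ) else 0) := by
    rw [← Finset.sum_add_distrib]
    have : ∀ v, ((if side v = true then (1 : ℝ) else 0) + if side v = false then (1:ℝ) else 0) = 1 := by
      intro v; cases side v <;> simp
    simp [this]
  rw [h1, h2, ← Finset.sum_add_distrib] at h3
  simp only [mul_one] at h3
  exact_mod_cast h3

/-- coefficient sequence -/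
def cc (α β : ℕ → ℤ) (h i : ℕ) : ℤ :=
  if i = 0 then -1 else if i % 2 = 1 then α (i / 2) - (if i = 1 then 1 else 0) else β (h - i / 2)

lemma cc_zero (α β : ℕ → ℤ) (h : ℕ) : cc α β h 0 = -1 := by simp [cc]
lemma cc_one (α β : ℕ → ℤ) (h : ℕ) : cc α β h 1 = α 0 - 1 := by simp [cc]
lemma cc_odd (α β : ℕ → ℤ) (h i : ℕ) :
    cc α β h (2 * i + 1) = α i - (if i = 0 then 1 else 0) := by
  have h1 : (2 * i + 1) % 2 = 1 := by omega
  have h2 : (2 * i + 1) / 2 = i := by omega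
  simp [cc, h1, h2]
lemma cc_even (α β : ℕ → ℤ) (h i : ℕ) : cc α β h (2 * i + 2) = β (h - (i + 1)) := by
  have h1 : ¬ (2 * i + 2) % 2 = 1 := by omega
  have h2 : (2 * i + 2) / 2 = i + 1 := by omega
  simp only [cc, if_neg h1, h2]
  simp

lemma sum_pairs {M : Type*} [AddCommMonoid M] (f : ℕ → M) (n : ℕ) :
    ∑ i ∈ Finset.range (2 * n), f i = ∑ i ∈ Finset.range n, (f (2 * i) + f (2 * i + 1)) := by
  induction n with
  | zero => simp
  | succ n ih =>
    rw [show 2 * (n + 1) = 2 * n + 1 + 1 by ring, Finset.sum_range_succ, Finset.sum_range_succ, ih,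
      Finset.sum_range_succ, add_assoc]

lemma sum_odd {M : Type*} [AddCommMonoid M] (f : ℕ → M) (n : ℕ) :
    ∑ i ∈ Finset.range (2 * n + 1), f i
      = f 0 + ∑ i ∈ Finset.range n, (f (2 * i + 1) + f (2 * i + 2)) := by
  rw [Finset.sum_range_succ', sum_pairs, add_comm]

lemma sum_cc (α β : ℕ → ℤ) (H : ℕ) : ((List.range (2 * (H + 1) + 1)).map (cc α β (H + 1))).sum
    = (∑ j ∈ Finset.range (H + 1), (α j + β j)) - 2 := by
  rw [show ((List.range (2 * (H + 1) + 1)).map (cc α β (H + 1))).sum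
    = ∑ i ∈ Finset.range (2 * (H + 1) + 1), cc α β (H + 1) i from rfl, sum_odd, cc_zero]
  simp only [cc_odd, cc_even]
  rw [Finset.sum_add_distrib, Finset.sum_add_distrib, Finset.sum_sub_distrib]
  have : ∑ x ∈ Finset.range (H + 1), β (H + 1 - (x + 1)) = ∑ x ∈ Finset.range (H + 1), β x := by
    rw [← Finset.sum_range_reflect]
    refine Finset.sum_congr rfl fun x hx => ?_
    rw [Finset.mem_range] at hx
    congr 1
    omega
  rw [this]
  simp
  ring

lemma tr_range (c : ℕ → ℤ) (z : ℕ → ℝ) (n : ℕ)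
    (hz : ∀ i < n, z (i + 2) = c i * z (i + 1) - z i) :
    tr ((List.range n).map c) (z 0, z 1) = (z n, z (n + 1)) := by
  induction n with
  | zero => rfl
  | succ n ih =>
    rw [List.range_succ, List.map_append, tr_append, ih fun i hi => hz i (by omega)]
    simp [tr, hz n (by omega)]

lemma en_range (c : ℕ → ℤ) (y : ℕ → ℝ) (n : ℕ) :
    en 0 ((List.range (n + 1)).map fun i => (c i, y i)) =
      ∑ i ∈ Finset.range (n + 1), c i * y i ^ 2 - 2 * ∑ i ∈ Finset.range n, y i * y (i + 1) ∧
    lastv 0 ((List.range (n + 1)).map fun i => (c i, y i)) = y n := by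
  induction n with
  | zero => simp [en, lastv]
  | succ n ih =>
    rw [List.range_succ, List.map_append, en_append, lastv_append, ih.1, ih.2,
      Finset.sum_range_succ _ (n + 1), Finset.sum_range_succ (fun i => y i * y (i + 1)) n]
    simp [en, lastv]
    ring

end kernel
end TwoPosEig

open Matrix BigOperators
namespace TwoPosEig
section kernel2
variable {V : Type*} [Fintype V] [DecidableEq V]
variable (G : SimpleGraph V) (h : ℕ) (side : V → Bool) (lev : V → ℕ)

/-- signed sequence attached to kernel vector -/
def zs (h : ℕ) (F K : ℕ → ℝ) (n : ℕ) : ℝ :=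
  if n = 0 then - K 0 - F 0 else if n = 1 then F 0
  else if n % 2 = 0 then (-1) ^ (n / 2 - 1) * K (n / 2 - 1) else (-1) ^ (n / 2) * F (h - n / 2)

lemma zs_even (F K : ℕ → ℝ) (i : ℕ) : zs h F K (2 * i + 2) = (-1) ^ i * K i := by
  have h1 : (2 * i + 2) % 2 = 0 := by omega
  have h2 : (2 * i + 2) / 2 - 1 = i := by omega
  simp only [zs, h1, h2]; simp
lemma zs_odd (F K : ℕ → ℝ) (i : ℕ) : zs h F K (2 * i + 3) = (-1) ^ (i + 1) * F (h - (i + 1)) := by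
  have h1 : (2 * i + 3) % 2 = 1 := by omega
  have h2 : (2 * i + 3) / 2 = i + 1 := by omega
  simp only [zs, h1, h2]; simp

lemma zs_rec (H : ℕ) (α β : ℕ → ℤ) (F K : ℕ → ℝ)
    (hK : ∀ i ≤ H, K (i + 1) = K i + β (H - i) * F (H - i))
    (hF : ∀ i ≤ H, F (i + 1) = F i + α (H - i) * K (H - i))
    (hF2 : F (H + 1) = K 0 + F 0) (i : ℕ) (hi : i < 2 * (H + 1) + 1) :
    zs (H + 1) F K (i + 2) = cc α β (H + 1) i * zs (H + 1) F K (i + 1) - zs (H + 1) F K i := by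
  rcases Nat.even_or_odd' i with ⟨j, rfl | rfl⟩
  · rcases j with _ | j
    · have := zs_even (H + 1) F K 0
      simp only [mul_zero, zero_add] at this ⊢
      rw [this, cc_zero]
      simp [zs]
      ring
    · rw [zs_even, show 2 * (j + 1) + 1 = 2 * j + 3 by ring, zs_odd,
        show 2 * (j + 1) = 2 * j + 2 by ring, zs_even, cc_even, hK j (by omega),
        show H + 1 - (j + 1) = H - j by omega]
      ring
  · rw [show 2 * j + 1 + 2 = 2 * j + 3 by ring, zs_odd, cc_odd,
      show 2 * j + 1 + 1 = 2 * j + 2 by ring, zs_even]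
    have hh := hF (H - j) (by omega)
    rw [show H - (H - j) = j by omega] at hh
    rw [show H + 1 - (j + 1) = H - j by omega]
    rcases j with _ | j
    · have e1 : zs (H + 1) F K (2 * 0 + 1) = F 0 := by simp [zs]
      rw [e1]
      simp at hh ⊢
      rw [hF2] at hh
      linarith
    · rw [show 2 * (j + 1) + 1 = 2 * j + 3 by ring, zs_odd]
      rw [show H - (j + 1) + 1 = H + 1 - (j + 1) by omega] at hh
      rw [hh]
      simp
      ring

/-- kernel relations -/
lemma ker_rel (H : ℕ) (hlev : ∀ v, lev v < H + 1)
    (hadj : ∀ u v, G.Adj u v ↔ u ≠ v ∧ (side u = side v ∨ H + 1 ≤ lev u + lev v))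
    (x : V → ℝ) (hx : adjMat G *ᵥ x = 0) :
    (∀ v, x v = Ws (H + 1) side lev x (side v) (lev v)) ∧
    (∀ s, ∀ i ≤ H, Ws (H + 1) side lev x s (i + 1) = Ws (H + 1) side lev x s i +
      cnt side lev (!s) (H - i) * Ws (H + 1) side lev x (!s) (H - i)) := by
  have h1 : ∀ v, x v = Ws (H + 1) side lev x (side v) (lev v) := by
    intro v
    have := congrFun hx v
    rw [Ws_adj G (H + 1) side lev hadj] at this
    simp at this
    linarith
  exact ⟨h1, fun s i hi => Ws_step (H + 1) side lev _ x h1 s i (H - i) (by omega)⟩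

/-- the map from the kernel to the pair of side sums -/
noncomputable def stMap (G : SimpleGraph V) (side : V → Bool) :
    LinearMap.ker (adjMat G).mulVecLin →ₗ[ℝ] ℝ × ℝ where
  toFun x := (∑ v, if side v = true then x.1 v else 0, ∑ v, if side v = false then x.1 v else 0)
  map_add' x y := by
    ext <;> simp [← Finset.sum_add_distrib] <;> refine Finset.sum_congr rfl fun v _ => ?_ <;>
      split_ifs <;> simp
  map_smul' c x := by
    ext <;> simp [Finset.mul_sum]

lemma stMap_inj (H : ℕ) (hlev : ∀ v, lev v < H + 1)
    (hadj : ∀ u v, G.Adj u v ↔ u ≠ v ∧ (side u = side v ∨ H + 1 ≤ lev u + lev v)) :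
    Function.Injective (stMap G side) := by
  rw [← LinearMap.ker_eq_bot, LinearMap.ker_eq_bot']
  rintro ⟨x, hx⟩ h0
  have hx' : adjMat G *ᵥ x = 0 := by simpa using hx
  obtain ⟨h1, h2⟩ := ker_rel G side lev H hlev hadj x hx'
  simp only [stMap, LinearMap.coe_mk, AddHom.coe_mk, Prod.mk_eq_zero] at h0
  have hS : Ws (H + 1) side lev x true 0 = 0 := by rw [Ws_zero _ _ _ hlev]; exact h0.1
  have hT : Ws (H + 1) side lev x false 0 = 0 := by rw [Ws_zero _ _ _ hlev]; exact h0.2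
  have hrec := zs_rec H (fun j => cnt side lev true j) (fun j => cnt side lev false j)
    (Ws (H + 1) side lev x false) (Ws (H + 1) side lev x true)
    (fun i hi => by simpa using h2 true i hi) (fun i hi => by simpa using h2 false i hi)
    (Ws_sum _ _ _ hlev _ _)
  have hz : ∀ n ≤ 2 * (H + 1) + 1, zs (H + 1) (Ws (H + 1) side lev x false)
      (Ws (H + 1) side lev x true) n = 0 ∧ zs (H + 1) (Ws (H + 1) side lev x false)
      (Ws (H + 1) side lev x true) (n + 1) = 0 := by
    intro n
    induction n with
    | zero => intro _; simp [zs, hS, hT]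
    | succ n ih =>
      intro hn
      obtain ⟨i1, i2⟩ := ih (by omega)
      refine ⟨i2, ?_⟩
      rw [hrec n (by omega), i1, i2]; simp
  apply Subtype.ext
  funext v
  change x v = 0
  rw [h1 v]
  have hl := hlev v
  cases hs : side v
  · have := (hz (2 * (H - lev v) + 3 ) (by omega)).1
    rw [zs_odd, show H + 1 - (H - lev v + 1) = lev v by omega] at this
    simpa using this
  · have := (hz (2 * lev v + 2) (by omega)).1
    rw [zs_even] at this
    simpa using this

lemma null_le_two (H : ℕ) (hlev : ∀ v, lev v < H + 1)
    (hadj : ∀ u v, G.Adj u v ↔ u ≠ v ∧ (side u = side v ∨ H + 1 ≤ lev u + lev v)) :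
    nullCount G ≤ 2 := by
  rw [nullCount_eq_finrank]
  have := LinearMap.finrank_le_finrank_of_injective (stMap_inj G side lev H hlev hadj)
  simpa using this

lemma ker_surj (H : ℕ) (hlev : ∀ v, lev v < H + 1)
    (hadj : ∀ u v, G.Adj u v ↔ u ≠ v ∧ (side u = side v ∨ H + 1 ≤ lev u + lev v))
    (h2 : 2 ≤ nullCount G) (S T : ℝ) : ∃ x, adjMat G *ᵥ x = 0 ∧
      Ws (H + 1) side lev x true 0 = S ∧ Ws (H + 1) side lev x false 0 = T := by
  have h3 := null_le_two G side lev H hlev hadj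
  have hfr : Module.finrank ℝ (LinearMap.ker (adjMat G).mulVecLin) = Module.finrank ℝ (ℝ × ℝ) := by
    rw [← nullCount_eq_finrank]; simp; omega
  have hs := (LinearMap.injective_iff_surjective_of_finrank_eq_finrank hfr).1
    (stMap_inj G side lev H hlev hadj)
  obtain ⟨⟨x, hx⟩, he⟩ := hs (S, T)
  simp only [stMap, LinearMap.coe_mk, AddHom.coe_mk, Prod.mk.injEq] at he
  refine ⟨x, by simpa using hx, ?_, ?_⟩
  · rw [Ws_zero _ _ _ hlev]; exact he.1
  · rw [Ws_zero _ _ _ hlev]; exact he.2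

lemma tr_cond (H : ℕ) (hlev : ∀ v, lev v < H + 1)
    (hadj : ∀ u v, G.Adj u v ↔ u ≠ v ∧ (side u = side v ∨ H + 1 ≤ lev u + lev v))
    (h2 : 2 ≤ nullCount G) (p y : ℝ) :
    tr ((List.range (2 * (H + 1) + 1)).map
      (cc (fun j => cnt side lev true j) (fun j => cnt side lev false j) (H + 1))) (p, y)
      = ((-1) ^ (H + 1) * y, -(-1) ^ (H + 1) * p) := by
  obtain ⟨x, hx, hS, hT⟩ := ker_surj G side lev H hlev hadj h2 (- p - y) y
  obtain ⟨h1, h2⟩ := ker_rel G side lev H hlev hadj x hx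
  have hrec := zs_rec H (fun j => cnt side lev true j) (fun j => cnt side lev false j)
    (Ws (H + 1) side lev x false) (Ws (H + 1) side lev x true)
    (fun i hi => by simpa using h2 true i hi) (fun i hi => by simpa using h2 false i hi)
    (Ws_sum _ _ _ hlev _ _)
  have := tr_range _ _ _ hrec
  rw [show 2 * (H + 1) + 1 + 1 = 2 * (H + 1) + 2 by ring, zs_even] at this
  rw [show zs (H + 1) (Ws (H + 1) side lev x false) (Ws (H + 1) side lev x true)
    (2 * (H + 1) + 1) = (-1) ^ (H + 1) * Ws (H + 1) side lev x false 0 by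
      rw [show 2 * (H + 1) + 1 = 2 * H + 3 by ring, zs_odd]; simp] at this
  rw [Ws_sum _ _ _ hlev, hS, hT] at this
  rw [show zs (H + 1) (Ws (H + 1) side lev x false) (Ws (H + 1) side lev x true) 0 = p by
    simp [zs, hS, hT], show zs (H + 1) (Ws (H + 1) side lev x false)
      (Ws (H + 1) side lev x true) 1 = y by simp [zs, hT]] at this
  rw [this]
  ext <;> simp

lemma not_k3 (hlev : ∀ v, lev v < 2)
    (hadj : ∀ u v, G.Adj u v ↔ u ≠ v ∧ (side u = side v ∨ 2 ≤ lev u + lev v))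
    (h2 : 2 ≤ nullCount G) (hA : ∃ v, side v = true ∧ lev v = 1) :
    ∃ v, side v = false ∧ lev v = 0 := by
  by_contra hcon
  obtain ⟨x, hx, hS, hT⟩ := ker_surj G side lev 1 hlev hadj h2 0 1
  obtain ⟨h1, h3⟩ := ker_rel G side lev 1 hlev hadj x hx
  have hc0 : cnt side lev false 0 = 0 := by
    rw [cnt, Finset.card_eq_zero, Finset.filter_eq_empty_iff]
    exact fun v _ hv => hcon ⟨v, hv⟩
  have hc1 : 0 < cnt side lev true 1 := by
    obtain ⟨v, hv⟩ := hA
    exact Finset.card_pos.2 ⟨v, by simpa using hv⟩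
  have e1 := h3 true 1 (by omega)
  have e2 := Ws_sum (1 + 1) side lev hlev x true
  have e3 : Ws (1 + 1) side lev x true 0 =
      ∑ v, if side v = true then Ws (1 + 1) side lev x (side v) (lev v) else 0 := by
    rw [Ws_zero _ _ _ hlev]
    refine Finset.sum_congr rfl fun v _ => by rw [← h1 v]
  rw [sum_side (1 + 1) side lev hlev (Ws (1 + 1) side lev x)] at e3
  rw [Finset.sum_range_succ, Finset.sum_range_succ] at e3
  simp [hc0] at e1
  simp only [hS, hT] at e2
  rw [hS] at e3
  simp [hS] at e3
  rcases e3 with e3 | e3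
  · omega
  · norm_num at e1 e2 e3; linarith
end kernel2
end TwoPosEig

open Matrix BigOperators
namespace TwoPosEig
section transfer
variable {V : Type*} [Fintype V] [DecidableEq V]
variable (G : SimpleGraph V) (side : V → Bool) (lev : V → ℕ)

lemma cross_eq (h : ℕ) (hlev : ∀ v, lev v < h) (x : V → ℝ) (s : Bool) :
    (∑ v, if side v = s then x v * (Ws h side lev x s (lev v) - Ws h side lev x s 0) else 0) =
      ∑ v, ∑ w, if side v = s ∧ side w = (!s) ∧ h ≤ lev v + lev w then x v * x w else 0 := by
  refine Finset.sum_congr rfl fun v _ => ?_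
  by_cases hv : side v = s
  · rw [if_pos hv, Ws_zero _ _ _ hlev, Ws, ← Finset.sum_sub_distrib, Finset.mul_sum]
    refine Finset.sum_congr rfl fun w _ => ?_
    simp only [hv, true_and]
    by_cases hw : side w = s
    · have : ¬ s = (!s) := by cases s <;> simp
      simp [hw, this]
    · have : side w = !s := by cases s <;> simpa using hw
      simp only [this, true_and]
      have h3 : ¬ (!s) = s := by cases s <;> simp
      simp only [h3, false_or, if_false]
      split_ifs <;> simp
  · simp [hv]

lemma cross_symm (h : ℕ) (hlev : ∀ v, lev v < h) (x : V → ℝ) :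
    (∑ v, if side v = true then x v * (Ws h side lev x true (lev v) - Ws h side lev x true 0)
      else 0) = (∑ v, if side v = false then
        x v * (Ws h side lev x false (lev v) - Ws h side lev x false 0) else 0) := by
  rw [cross_eq side lev h hlev, cross_eq side lev h hlev, Finset.sum_comm]
  refine Finset.sum_congr rfl fun v _ => Finset.sum_congr rfl fun w _ => ?_
  have : (side w = true ∧ side v = (!true) ∧ h ≤ lev w + lev v) ↔
      (side v = false ∧ side w = (!false) ∧ h ≤ lev v + lev w) := by
    rw [add_comm]; simp; tauto
  simp only [this, mul_comm]

lemma form_eq (H : ℕ) (hlev : ∀ v, lev v < H + 1)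
    (hadj : ∀ u v, G.Adj u v ↔ u ≠ v ∧ (side u = side v ∨ H + 1 ≤ lev u + lev v))
    (g : Bool → ℕ → ℝ) (x : V → ℝ) (hx : ∀ v, x v = g (side v) (lev v))
    (hg : ∀ i < H, g true (i + 1) = g true i + cnt side lev false (H - i) * g false (H - i)) :
    ∃ S T : ℝ, T = cnt side lev false 0 * g false 0 + g true H - g true 0 ∧
      x ⬝ᵥ (adjMat G *ᵥ x) = S ^ 2 - 2 * S * g true 0 + T ^ 2
        + ∑ j ∈ Finset.range (H + 1), cnt side lev true j * (g true j) ^ 2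
        - ∑ j ∈ Finset.range (H + 1), cnt side lev false j * (g false j) ^ 2 := by
  set S := Ws (H + 1) side lev x true 0 with hS
  set T := Ws (H + 1) side lev x false 0 with hT
  have hW : ∀ i ≤ H, Ws (H + 1) side lev x true i = S + g true i - g true 0 := by
    intro i
    induction i with
    | zero => intro _; simp [hS]
    | succ i ih =>
      intro hi
      rw [Ws_step (H + 1) side lev g x hx true i (H - i) (by omega), ih (by omega),
        hg i (by omega)]
      simp; ring
  have hT' : T = cnt side lev false 0 * g false 0 + g true H - g true 0 := by
    have := Ws_step (H + 1) side lev g x hx true H 0 (by omega)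
    rw [Ws_sum _ _ _ hlev, ← hS, ← hT, hW H le_rfl] at this
    simp at this
    linarith
  refine ⟨S, T, hT', ?_⟩
  have hc := cross_symm side lev (H + 1) hlev x
  have e1 : (∑ v, if side v = true then x v * (Ws (H + 1) side lev x true (lev v) - S) else 0)
      = ∑ j ∈ Finset.range (H + 1), cnt side lev true j * (g true j) ^ 2 - S * g true 0 := by
    have h1 : (∑ v, if side v = true then x v * (Ws (H + 1) side lev x true (lev v) - S) else 0)
        = (∑ v, if side v = true then g (side v) (lev v) ^ 2 else 0)
          - (∑ v, if side v = true then x v else 0) * g true 0 := by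
      rw [Finset.sum_mul, ← Finset.sum_sub_distrib]
      refine Finset.sum_congr rfl fun v _ => ?_
      by_cases hv : side v = true
      · simp only [hv, if_true]
        rw [hW _ (by have := hlev v; omega), hx v, hv]; ring
      · simp [hv]
    rw [h1, sum_side (H + 1) side lev hlev (fun s i => g s i ^ 2), hS, Ws_zero _ _ _ hlev]
  have e2 : x ⬝ᵥ (adjMat G *ᵥ x) =
      (∑ v, if side v = true then x v * (Ws (H + 1) side lev x true (lev v) - S) else 0)
      + (∑ v, if side v = false then x v * (Ws (H + 1) side lev x false (lev v) - T) else 0)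
      + (∑ v, if side v = true then x v else 0) * S + (∑ v, if side v = false then x v else 0) * T
      - (∑ v, if side v = true then g (side v) (lev v) ^ 2 else 0)
      - (∑ v, if side v = false then g (side v) (lev v) ^ 2 else 0) := by
    rw [Finset.sum_mul, Finset.sum_mul, ← Finset.sum_add_distrib, ← Finset.sum_add_distrib,
      ← Finset.sum_add_distrib, ← Finset.sum_sub_distrib, ← Finset.sum_sub_distrib]
    refine Finset.sum_congr rfl fun v _ => ?_
    rw [Ws_adj G (H + 1) side lev hadj, hx v]
    cases side v <;> simp <;> ring
  rw [e2, ← hc, e1, sum_side (H + 1) side lev hlev (fun s i => g s i ^ 2),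
    sum_side (H + 1) side lev hlev (fun s i => g s i ^ 2), ← Ws_zero _ _ _ hlev,
    ← Ws_zero _ _ _ hlev, ← hS, ← hT]
  ring

lemma energy_eq (H : ℕ) (α β : ℕ → ℤ) (X Y y : ℕ → ℝ) (h0 : y 0 = Y 0)
    (h1 : ∀ i ≤ H, y (2 * i + 1) = (-1) ^ i * X i)
    (h2 : ∀ i ≤ H, y (2 * i + 2) = (-1) ^ (i + 1) * Y (H - i))
    (hg : ∀ i < H, X (i + 1) = X i + β (H - i) * Y (H - i)) :
    en 0 ((List.range (2 * (H + 1) + 1)).map fun i => (cc α β (H + 1) i, y i)) =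
      ∑ j ∈ Finset.range (H + 1), α j * X j ^ 2 - ∑ j ∈ Finset.range (H + 1), β j * Y j ^ 2
      + 2 * β 0 * Y 0 ^ 2 - (X 0 + Y 0) ^ 2 + 2 * X H * Y 0 := by
  have hsq : ∀ i : ℕ, ((-1 : ℝ) ^ i) * (-1) ^ i = 1 := fun i => by
    rw [← mul_pow]; simp
  have hR : ∑ j ∈ Finset.range (H + 1), (β j : ℝ) * Y j ^ 2
      = ∑ i ∈ Finset.range (H + 1), (β (H - i) : ℝ) * Y (H - i) ^ 2 := by
    rw [← Finset.sum_range_reflect]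
    refine Finset.sum_congr rfl fun x hx => ?_
    rw [show H + 1 - 1 - x = H - x by omega]
  have hR2 : ∑ i ∈ Finset.range (H + 1), (β (H - i) : ℝ) * Y (H - i) ^ 2
      = ∑ i ∈ Finset.range H, (β (H - i) : ℝ) * Y (H - i) ^ 2 + β 0 * Y 0 ^ 2 := by
    rw [Finset.sum_range_succ]; simp
  rw [(en_range _ _ _).1, sum_odd, sum_pairs, cc_zero]
  have q1 : ∑ i ∈ Finset.range (H + 1), ((cc α β (H + 1) (2 * i + 1) : ℝ) * y (2 * i + 1) ^ 2
      + (cc α β (H + 1) (2 * i + 2) : ℝ) * y (2 * i + 2) ^ 2) =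
      ∑ j ∈ Finset.range (H + 1), (α j : ℝ) * X j ^ 2 - X 0 ^ 2 +
      ∑ i ∈ Finset.range (H + 1), (β (H - i) : ℝ) * Y (H - i) ^ 2 := by
    have : X 0 ^ 2 = ∑ i ∈ Finset.range (H + 1), if i = 0 then X i ^ 2 else 0 := by simp
    rw [this, ← Finset.sum_sub_distrib, ← Finset.sum_add_distrib]
    refine Finset.sum_congr rfl fun i hi => ?_
    rw [Finset.mem_range] at hi
    rw [cc_odd, cc_even, h1 i (by omega), h2 i (by omega), mul_pow, mul_pow, sq ((-1 : ℝ) ^ i),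
      sq ((-1 : ℝ) ^ (i + 1)), hsq, hsq, show H + 1 - (i + 1) = H - i by omega]
    split_ifs <;> push_cast <;> ring
  have q2 : ∑ i ∈ Finset.range (H + 1), (y (2 * i) * y (2 * i + 1) +
      y (2 * i + 1) * y (2 * i + 1 + 1)) = X 0 * Y 0 +
      ∑ i ∈ Finset.range H, (β (H - i) : ℝ) * Y (H - i) ^ 2 - X H * Y 0 := by
    rw [Finset.sum_add_distrib, Finset.sum_range_succ', Finset.sum_range_succ _ H]
    have e1 : y (2 * 0) * y (2 * 0 + 1) = X 0 * Y 0 := by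
      have := h1 0 (by omega)
      simp only [mul_zero, zero_add] at this ⊢
      rw [h0, this]; simp; ring
    have e2 : y (2 * H + 1) * y (2 * H + 1 + 1) = - (X H * Y 0) := by
      rw [h1 H le_rfl, show 2 * H + 1 + 1 = 2 * H + 2 by ring, h2 H le_rfl]
      have := hsq H
      rw [pow_succ]; simp
      linear_combination ((X H * Y 0)) * this
    rw [e1, e2]
    have e3 : ∑ i ∈ Finset.range H, y (2 * (i + 1)) * y (2 * (i + 1) + 1) +
        ∑ i ∈ Finset.range H, y (2 * i + 1) * y (2 * i + 1 + 1) =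
        ∑ i ∈ Finset.range H, (β (H - i) : ℝ) * Y (H - i) ^ 2 := by
      rw [← Finset.sum_add_distrib]
      refine Finset.sum_congr rfl fun i hi => ?_
      rw [Finset.mem_range] at hi
      rw [h1 (i + 1) (by omega), h1 i (by omega), show 2 * (i + 1) = 2 * i + 2 by ring,
        show 2 * i + 1 + 1 = 2 * i + 2 by ring, h2 i (by omega), hg i hi]
      have := hsq i
      rw [pow_succ]
      linear_combination (β (H - i) * Y (H - i) ^ 2) * this
    linarith
  rw [q1, q2, hR, hR2, h0]
  push_cast
  ring

lemma list_eq_range {γ : Type*} (l : List γ) (q : γ) :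
    l = (List.range l.length).map fun i => l.getD i q := by
  apply List.ext_getElem
  · simp
  · intro i h1 h2
    simp [h1]

lemma card_bound (H : ℕ) (hlev : ∀ v, lev v < H + 1)
    (hadj : ∀ u v, G.Adj u v ↔ u ≠ v ∧ (side u = side v ∨ H + 1 ≤ lev u + lev v))
    (h2 : 2 ≤ nullCount G) (hp : posCount G ≤ 2) : Fintype.card V ≤ 14 := by
  obtain ⟨d, hd, L, hL, hlast, hpos, hdef⟩ := Q_lemma (2 * (H + 1) + 1) _ ((-1) ^ (H + 1))
    (by simp) (by omega) (tr_cond G side lev H hlev hadj h2)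
  rw [sum_cc, ← card_eq_cnt (H + 1) side lev hlev] at hd
  have hlen : L.length = 2 * (H + 1) + 1 := by
    have := congrArg List.length hL
    simpa using this
  let yf : ℕ → ((Fin d → ℝ) →ₗ[ℝ] ℝ) := fun i => (L.getD i (0, 0)).2
  have hfst : ∀ i < 2 * (H + 1) + 1, (L.getD i (0, 0)).1 =
      cc (fun j => cnt side lev true j) (fun j => cnt side lev false j) (H + 1) i := by
    intro i hi
    have e : (L.map Prod.fst)[i]? = some (cc (fun j => (cnt side lev true j : ℤ))
        (fun j => (cnt side lev false j : ℤ)) (H + 1) i) := by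
      rw [hL]; simp [hi]
    have hi' : i < L.length := by omega
    simp [hi'] at e ⊢
    exact e
  have hev : ∀ u, ev u L = (List.range (2 * (H + 1) + 1)).map fun i =>
      (cc (fun j => cnt side lev true j) (fun j => cnt side lev false j) (H + 1) i, yf i u) := by
    intro u
    conv_lhs => rw [list_eq_range L (0, 0), hlen]
    rw [ev, List.map_map]
    refine List.map_congr_left fun i hi => ?_
    rw [List.mem_range] at hi
    simp only [Function.comp, yf]
    rw [hfst i hi]
  let X : ℕ → ((Fin d → ℝ) →ₗ[ℝ] ℝ) := fun i => ((-1 : ℝ) ^ i) • yf (2 * i + 1)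
  let Y : ℕ → ((Fin d → ℝ) →ₗ[ℝ] ℝ) := fun j => ((-1 : ℝ) ^ (H + 1 - j)) • yf (2 * (H + 1 - j))
  have hsq : ∀ i : ℕ, ((-1 : ℝ) ^ i) * (-1) ^ i = 1 := fun i => by
    rw [← mul_pow]; simp
  have hX : ∀ i u, yf (2 * i + 1) u = (-1) ^ i * X i u := by
    intro i u
    simp only [X, LinearMap.smul_apply, smul_eq_mul]
    linear_combination (- yf (2 * i + 1) u) * hsq i
  have hY : ∀ i ≤ H, ∀ u, yf (2 * i + 2) u = (-1) ^ (i + 1) * Y (H - i) u := by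
    intro i hi u
    simp only [Y, LinearMap.smul_apply, smul_eq_mul]
    rw [show H + 1 - (H - i) = i + 1 by omega, show 2 * (i + 1) = 2 * i + 2 by ring]
    linear_combination (- yf (2 * i + 2) u) * hsq (i + 1)
  have hY0 : ∀ u, yf 0 u = Y 0 u := by
    intro u
    have e := hlast u
    rw [hev, (en_range _ _ _).2] at e
    have e' : headv ((List.range (2 * (H + 1) + 1)).map fun i =>
      (cc (fun j => (cnt side lev true j : ℤ)) (fun j => (cnt side lev false j : ℤ)) (H + 1) i,
        yf i u)) = yf 0 u := by
      rw [List.range_succ_eq_map]; rfl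
    rw [e'] at e
    simp only [Y, LinearMap.smul_apply, smul_eq_mul]
    rw [show H + 1 - 0 = H + 1 by omega, e]
    linear_combination (- yf 0 u) * hsq (H + 1)
  let Φ : (Fin d → ℝ) →ₗ[ℝ] (Fin H → ℝ) := LinearMap.pi fun i =>
    X (i + 1) - X i - (cnt side lev false (H - i) : ℝ) • Y (H - i)
  have hfr : d ≤ Module.finrank ℝ (LinearMap.ker Φ) + H := by
    have e1 := LinearMap.finrank_range_add_finrank_ker Φ
    have e2 := Submodule.finrank_le (LinearMap.range Φ)
    simp at e1 e2
    omega
  let f : LinearMap.ker Φ →ₗ[ℝ] (V → ℝ) := (LinearMap.pi fun v =>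
    if side v = true then X (lev v) else Y (lev v)) ∘ₗ (LinearMap.ker Φ).subtype
  have := finrank_le_posCount G f (by
    rintro ⟨u, hu⟩ hne
    have hu0 : u ≠ 0 := fun h => hne (Subtype.ext h)
    have hg : ∀ i < H, X (i + 1) u = X i u + (cnt side lev false (H - i) : ℝ) * Y (H - i) u := by
      intro i hi
      have := congrFun (LinearMap.mem_ker.1 hu) ⟨i, hi⟩
      simp [Φ] at this
      linarith
    obtain ⟨S, T, hT, hform⟩ := form_eq G side lev H hlev hadj
      (fun s i => if s = true then X i u else Y i u) (f ⟨u, hu⟩) (by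
        intro v
        simp only [f, LinearMap.comp_apply, LinearMap.pi_apply, Submodule.subtype_apply]
        split_ifs <;> rfl) (by simpa using hg)
    have hE := energy_eq H (fun j => cnt side lev true j) (fun j => cnt side lev false j)
      (fun i => X i u) (fun i => Y i u) (fun i => yf i u) (hY0 u) (fun i _ => hX i u)
      (fun i hi => hY i hi u) (by simpa using hg)
    rw [← hev] at hE
    have hp1 : 0 < en 0 (ev u L) :=
      lt_of_le_of_ne (hpos u) (fun h => hu0 (hdef u h.symm))
    rw [hform]
    simp at hT hE ⊢
    rw [hE] at hp1
    rw [hT]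
    nlinarith [sq_nonneg (S - X 0 u),
      sq_nonneg ((cnt side lev false 0 : ℝ) * Y 0 u + X H u - X 0 u - Y 0 u)])
  push_cast at hd
  omega
end transfer
end TwoPosEig

open Matrix BigOperators
namespace TwoPosEig
section final
variable {V : Type*} [Fintype V] [DecidableEq V]

lemma list_lam (a b c d : ℝ) (t : List ℝ) (h : (a :: b :: c :: d :: t).Pairwise (· ≥ ·)) :
    ((c = 0 ∧ d = 0) → (a :: b :: c :: d :: t).countP (fun x => decide (0 < x)) ≤ 2 ∧
      4 ≤ (a :: b :: c :: d :: t).countP (fun x => decide (0 < x)) +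
        (a :: b :: c :: d :: t).countP (fun x => decide (x = 0))) ∧
    ((a :: b :: c :: d :: t).countP (fun x => decide (0 < x)) = 2 →
      (a :: b :: c :: d :: t).countP (fun x => decide (x = 0)) = 2 → c = 0 ∧ d = 0) := by
  simp only [List.pairwise_cons, List.mem_cons, forall_eq_or_imp] at h
  obtain ⟨⟨hab, hac, had, hat⟩, ⟨hbc, hbd, hbt⟩, ⟨hcd, hct⟩, hdt, ht⟩ := h
  have zp : d ≤ 0 → t.countP (fun x => decide (0 < x)) = 0 := by
    intro hd
    rw [List.countP_eq_zero]
    intro x hx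
    have := hdt x hx
    simp; linarith
  have zz : d < 0 → t.countP (fun x => decide (x = 0)) = 0 := by
    intro hd
    rw [List.countP_eq_zero]
    intro x hx
    have := hdt x hx
    simp; intro h; linarith
  simp only [List.countP_cons]
  constructor
  · rintro ⟨rfl, rfl⟩
    rw [zp le_rfl]
    have ha : 0 < a ∨ a = 0 := by rcases lt_or_eq_of_le hac with h | h <;> simp [h]
    have hb : 0 < b ∨ b = 0 := by rcases lt_or_eq_of_le hbc with h | h <;> simp [h]
    rcases ha with ha | ha <;> rcases hb with hb | hb <;> simp [ha, hb, ne_of_gt] <;> omega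
  · intro h1 h2
    have hd0 : d = 0 := by
      rcases lt_trichotomy d 0 with hd | hd | hd
      · rw [zp hd.le] at h1
        rw [zz hd] at h2
        exfalso
        rcases lt_trichotomy a 0 with ha | ha | ha <;> rcases lt_trichotomy b 0 with hb | hb | hb <;>
          rcases lt_trichotomy c 0 with hc | hc | hc <;>
          simp [ha, hb, hc, hd, not_lt_of_gt, ne_of_gt, ne_of_lt] at h1 h2
      · exact hd
      · have : 0 < c := by linarith
        have : 0 < b := by linarith
        have : 0 < a := by linarith
        simp [*] at h1
    refine ⟨?_, hd0⟩
    by_contra hc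
    have : 0 < c := lt_of_le_of_ne (by linarith) (Ne.symm hc)
    have : 0 < b := by linarith
    have : 0 < a := by linarith
    simp [*] at h1

lemma lam_iff (G : SimpleGraph V) (h4 : 4 ≤ Fintype.card V) :
    ((lam G 3 = 0 ∧ lam G 4 = 0) → posCount G ≤ 2 ∧ 4 ≤ posCount G + nullCount G) ∧
    (posCount G = 2 → nullCount G = 2 → lam G 3 = 0 ∧ lam G 4 = 0) := by
  classical
  unfold lam posCount nullCount
  rw [Fintype.card_eq_nat_card] at h4
  letI := Fintype.ofFinite V
  letI := Classical.decEq V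
  rw [← Fintype.card_eq_nat_card] at h4
  generalize hl : ((Finset.univ.val.map (eigs G)).sort (· ≤ ·)).reverse = l
  have hs : l.Pairwise (· ≥ ·) := by
    rw [← hl, List.pairwise_reverse]
    exact Multiset.pairwise_sort _ _
  have hm : (l : Multiset ℝ) = Finset.univ.val.map (eigs G) := by
    rw [← hl, ← Multiset.coe_reverse]; simp
  have hp : ∀ (p : ℝ → Prop) [DecidablePred p], Nat.card {i // p (eigs G i)} = l.countP (fun x => decide (p x)) := by
    intro p _
    rw [← Multiset.coe_countP, hm, Multiset.countP_map, Nat.card_eq_fintype_card, Fintype.card_subtype]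
    rfl
  have hlen : l.length = Fintype.card V := by
    rw [← Multiset.coe_card, hm]; simp
  rw [hp (fun x => 0 < x), hp (fun x => x = 0)]
  match l, hlen, hs with
  | a :: b :: c :: d :: t, _, hs => 
    have := list_lam a b c d t hs
    simpa using this
  | [], h, _ => simp at h; omega
  | [a], h, _ => simp at h; omega
  | [a, b], h, _ => simp at h; omega
  | [a, b, c], h, _ => simp at h; omega

lemma complete_null (G : SimpleGraph V) (h2 : 2 ≤ Fintype.card V) (hc : ∀ u v, u ≠ v → G.Adj u v) :
    nullCount G = 0 := by
  classical
  rw [nullCount_eq_finrank, Submodule.finrank_eq_zero, LinearMap.ker_eq_bot']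
  intro x hx
  have h : ∀ v, x v = ∑ w, x w := by
    intro v
    have := congrFun hx v
    rw [Matrix.mulVecLin_apply, adjMat_mulVec] at this
    have e : ∀ w, (if G.Adj v w then x w else 0) = x w - (if v = w then x w else 0) := by
      intro w
      by_cases hw : v = w
      · subst hw; simp
      · simp [hw, hc v w hw]
    simp only [e, Finset.sum_sub_distrib] at this
    simp at this
    linarith
  have h0 : ∑ w, x w = 0 := by
    have : ∑ w, x w = ∑ w : V, ∑ w, x w := Finset.sum_congr rfl fun v _ => h v
    rw [Finset.sum_const, Finset.card_univ, nsmul_eq_mul] at this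
    have hcard : (2 : ℝ) ≤ Fintype.card V := by exact_mod_cast h2
    have h3 : ((Fintype.card V : ℝ) - 1) * ∑ w, x w = 0 := by linarith
    rcases mul_eq_zero.1 h3 with h4 | h4
    · linarith
    · exact h4
  ext v
  rw [h v, h0]; rfl

lemma bGraph_null (k : ℕ) (hk : 4 ≤ k) (nn : Fin k → ℕ) : nullCount (bGraph k nn) ≤ 2 := by
  classical
  refine null_le_two (bGraph k nn) (fun v => v.1.isLeft)
    (fun v => Sum.elim (fun i : Fin ((k + 1) / 2) => (i : ℕ)) (fun j : Fin (k / 2) => (j : ℕ) + ((k + 1) / 2 - k / 2)) v.1)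
    ((k + 1) / 2 - 1) ?_ ?_
  · rintro ⟨i | j, x⟩
    · have := i.2; simp; omega
    · have := j.2; simp; omega
  · rintro ⟨i | j, x⟩ ⟨i' | j', y⟩ <;>
      simp only [bGraph, lexProd, SimpleGraph.fromRel_adj, oboudi_ll, oboudi_rr, oboudi_lr,
        SimpleGraph.adj_comm (oboudi k) (Sum.inr _) (Sum.inl _), Sum.elim_inl, Sum.elim_inr]
    · simp [em]; 
    · have := i.2; have := j'.2
      simp; omega
    · have := i'.2; have := j.2
      simp; omega
    · simp [em]; 

lemma bGraph_card (k : ℕ) (nn : Fin k → ℕ) (h : ∀ i, 1 ≤ nn i) :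
    k ≤ Fintype.card (Σ v : Fin ((k + 1) / 2) ⊕ Fin (k / 2), Fin (nn (toIdx v))) := by
  rw [Fintype.card_sigma]
  simp only [Fintype.card_fin]
  calc k = ∑ v : Fin ((k + 1) / 2) ⊕ Fin (k / 2), 1 := by simp; omega
    _ ≤ _ := Finset.sum_le_sum fun v _ => h _

lemma dstar_class {n : ℕ} (G : SimpleGraph (Fin n)) (h : memDstar G) : memClass 2 G := by
  classical
  obtain ⟨k, nn, hk, -, h1, -, l3, l4, ⟨e⟩⟩ := h
  obtain ⟨e1, e2⟩ := iso_congr _ _ e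
  have hc := bGraph_card k nn h1
  have hl := (lam_iff (bGraph k nn) (by omega)).1 ⟨l3, l4⟩
  have := bGraph_null k hk nn
  constructor <;> omega

lemma noCong_case {n : ℕ} (hn : 6 ≤ n) (G : SimpleGraph (Fin n)) (hconn : G.Connected)
    (hne : ∀ v, ∃ w, G.Adj v w) (hc : NoCong G) (s : ℕ) (hs : 2 ≤ s) (hm : memClass s G) :
    s = 2 ∧ memDstar G := by
  classical
  obtain ⟨hp, hz⟩ := hm
  have hnc : ∃ u v, u ≠ v ∧ ¬ G.Adj u v := by
    by_contra hcon
    push Not at hcon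
    have := complete_null G (by simp; omega) hcon
    omega
  obtain ⟨B, hcl, hnest, ha, hb⟩ := two_cliques G hne hp.le hc hnc
  obtain ⟨h, side, lev, h2, hlev, hadj, hA, hB⟩ := exists_levels G hconn B hcl hnest ha hb
  obtain ⟨H, rfl⟩ : ∃ H, h = H + 1 := ⟨h - 1, by omega⟩
  have hnull := null_le_two G side lev H hlev hadj
  have hs2 : s = 2 := by omega
  subst hs2
  refine ⟨rfl, ?_⟩
  have hcard := card_bound G side lev H hlev hadj hz.ge hp.le
  obtain ⟨k, hk, hkn, nn, hn1, hsum, ⟨e⟩⟩ := levels_iso G (H + 1) side lev h2 hlev hadj hA hB (by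
    intro hH
    rw [hH] at hlev hadj
    exact not_k3 G side lev hlev hadj hz.ge (hA 1 (by omega)))
  obtain ⟨e1, e2⟩ := iso_congr _ _ e
  have hc := bGraph_card k nn hn1
  obtain ⟨l3, l4⟩ := (lam_iff (bGraph k nn) (by omega)).2 (by omega) (by omega)
  exact ⟨k, nn, hk, by omega, hn1, by omega, l3, l4, ⟨e⟩⟩

lemma cong_iff {n : ℕ} (hn : 6 ≤ n) (G : SimpleGraph (Fin n)) (hconn : G.Connected)
    (s : ℕ) (hs : 2 ≤ s) :
    (memG1 s G ∨ memG2 s G ∨ memG3 s G → memClass s G) ∧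
    (memClass s G → (memG1 s G ∨ memG2 s G ∨ memG3 s G) ∨ (s = 2 ∧ memDstar G)) := by
  classical
  have hne : ∀ v, ∃ w, G.Adj v w := by
    haveI : Nontrivial (Fin n) := Fin.nontrivial_iff_two_le.2 (by omega)
    intro v
    exact hconn.preconnected.exists_adj_of_nontrivial v
  constructor
  · rintro (⟨-, v, hv, hm⟩ | ⟨-, v, hv, hm⟩ | ⟨-, v, hv, hm⟩)
    · exact (memClass_I G v hv s (by omega)).2 hm
    · exact (memClass_II G hne v hv s (by omega)).2 hm
    · exact (memClass_III G v hv s (by omega)).2 hm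
  · intro hm
    by_cases hc : NoCong G
    · exact Or.inr (noCong_case hn G hconn hne hc s hs hm)
    · left
      unfold NoCong at hc
      push Not at hc
      obtain ⟨v, hv⟩ := hc
      by_cases h1 : ITypeVertex G v
      · exact Or.inl ⟨hconn, v, h1, (memClass_I G v h1 s (by omega)).1 hm⟩
      · by_cases h2 : IITypeVertex G v
        · exact Or.inr (Or.inl ⟨hconn, v, h2, (memClass_II G hne v h2 s (by omega)).1 hm⟩)
        · have h3 := hv h1 h2
          exact Or.inr (Or.inr ⟨hconn, v, h3, (memClass_III G v h3 s (by omega)).1 hm⟩)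

end final

theorem connected_characterization {n : ℕ} (hn : 6 ≤ n) (G : SimpleGraph (Fin n))
    (hconn : G.Connected) :
    (memClass 2 G ↔ (memG1 2 G ∨ memG2 2 G ∨ memG3 2 G ∨ memDstar G)) ∧
    (∀ s : ℕ, 3 ≤ s → s ≤ n - 3 →
      (memClass s G ↔ (memG1 s G ∨ memG2 s G ∨ memG3 s G))) := by
  refine ⟨⟨fun h => ?_, fun h => ?_⟩, fun s hs _ => ⟨fun h => ?_, fun h => ?_⟩⟩
  · have := (cong_iff hn G hconn 2 le_rfl).2 h
    tauto
  · have := (cong_iff hn G hconn 2 le_rfl).1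
    have h2 := dstar_class G
    tauto
  · rcases (cong_iff hn G hconn s (by omega)).2 h with h | ⟨h, -⟩
    · exact h
    · omega
  · exact (cong_iff hn G hconn s (by omega)).1 h
end TwoPosEig
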